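/- arXiv:1807.00580 — 4 statements merged into one kernel-verified Lean document; each statement's English description precedes it below -/
import Mathlib

section
/- Every connected 3-regular graph G has edge metric dimension β_E(G) ≥ 3. -/
open SimpleGraph

/-- Distance from a vertex to an edge: `d(w,e) = min over endpoints`. -/
noncomputable def edgeDist {V : Type*} (G : SimpleGraph V) (w : V) (e : Sym2 V) : ℕ :=
  Sym2.lift ⟨fun x y => min (G.dist w x) (G.dist w y), fun x y => min_comm _ _⟩ e

/-- `S` is an edge metric generator: distinct edges get distinct distance vectors. -/
def IsEdgeGenerator {V : Type*} (G : SimpleGraph V) (S : Set V) : Prop :=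
  ∀ e₁ ∈ G.edgeSet, ∀ e₂ ∈ G.edgeSet,
    (∀ w ∈ S, edgeDist G w e₁ = edgeDist G w e₂) → e₁ = e₂

/-- The edge metric dimension: minimum cardinality of an edge metric generator. -/
noncomputable def edgeMetricDim {V : Type*} (G : SimpleGraph V) : ℕ :=
  sInf {n | ∃ S : Set V, S.Finite ∧ S.ncard = n ∧ IsEdgeGenerator G S}

/-- `S` resolves all pairs of vertices. -/
def IsResolving {V : Type*} (G : SimpleGraph V) (S : Set V) : Prop :=
  ∀ x y : V, (∀ w ∈ S, G.dist w x = G.dist w y) → x = y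

/-- The metric dimension. -/
noncomputable def metricDim {V : Type*} (G : SimpleGraph V) : ℕ :=
  sInf {n | ∃ S : Set V, S.Finite ∧ S.ncard = n ∧ IsResolving G S}

/-- The generalized Petersen graph `GP n k`: outer vertices `Sum.inl i` (the `uᵢ`),
inner vertices `Sum.inr i` (the `vᵢ`). -/
def GP (n k : ℕ) : SimpleGraph (Fin n ⊕ Fin n) :=
  SimpleGraph.fromRel (fun a b =>
    match a, b with
    | Sum.inl i, Sum.inl j => (j : ℕ) = ((i : ℕ) + 1) % n
    | Sum.inl i, Sum.inr j => i = j
    | Sum.inr i, Sum.inr j => (j : ℕ) = ((i : ℕ) + k) % n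
    | _, _ => False)

theorem edgeDist_mk' {V : Type*} (G : SimpleGraph V) (w x y : V) :
    edgeDist G w s(x, y) = min (G.dist w x) (G.dist w y) := rfl

theorem edgeDist_eq_zero' {V : Type*} (G : SimpleGraph V) (hc : G.Connected) (w : V)
    (e : Sym2 V) : edgeDist G w e = 0 ↔ w ∈ e := by
  induction e with
  | h x y =>
    rw [edgeDist_mk', Sym2.mem_iff, ← hc.dist_eq_zero_iff (u := w) (v := x),
      ← hc.dist_eq_zero_iff (u := w) (v := y)]
    omega

theorem no_two' {V : Type*} [Fintype V] (G : SimpleGraph V) [DecidableRel G.Adj]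
    (hc : G.Connected) (hreg : G.IsRegularOfDegree 3) (a b : V) (S : Set V)
    (hS : S ⊆ {a, b}) (h : IsEdgeGenerator G S) : False := by
  classical
  have hcard : (G.neighborFinset a).card = 3 := hreg a
  have hm : ∀ x ∈ G.neighborFinset a,
      edgeDist G b s(a, x) ∈ ({G.dist b a, G.dist b a - 1} : Finset ℕ) := by
    intro x hx
    rw [mem_neighborFinset] at hx
    have h1 : G.dist x a = 1 := dist_eq_one_iff_adj.2 hx.symm
    have h2 := hc.dist_triangle (u := b) (v := x) (w := a)
    rw [edgeDist_mk', Finset.mem_insert, Finset.mem_singleton]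
    omega
  have hlt : ({G.dist b a, G.dist b a - 1} : Finset ℕ).card < (G.neighborFinset a).card := by
    have := Finset.card_le_two (a := G.dist b a) (b := G.dist b a - 1)
    omega
  obtain ⟨x, hx, y, hy, hne, heq⟩ := Finset.exists_ne_map_eq_of_card_lt_of_maps_to hlt hm
  rw [mem_neighborFinset] at hx hy
  have := h s(a, x) hx s(a, y) hy (by
    intro w hw
    rcases hS hw with rfl | hw
    · simp [edgeDist_mk']
    · rw [Set.mem_singleton_iff.1 hw]; exact heq)
  exact hne (Sym2.congr_right.1 this)

/-- Every connected 3-regular graph has edge metric dimension at least 3. -/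
theorem stmt2 {V : Type*} [Fintype V] (G : SimpleGraph V) [DecidableRel G.Adj]
    (hc : G.Connected) (hreg : G.IsRegularOfDegree 3) :
    3 ≤ edgeMetricDim G := by
  unfold edgeMetricDim
  apply le_csInf
  · refine ⟨_, Set.univ, Set.finite_univ, rfl, ?_⟩
    intro e₁ _ e₂ _ h
    ext w
    rw [← edgeDist_eq_zero' G hc, ← edgeDist_eq_zero' G hc, h w (Set.mem_univ w)]
  · rintro n ⟨S, hfin, rfl, hS⟩
    by_contra hlt
    obtain ⟨v⟩ := hc.nonempty
    have hcases : S.ncard = 0 ∨ S.ncard = 1 ∨ S.ncard = 2 := by omega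
    rcases hcases with h0 | h1 | h2
    · rw [Set.ncard_eq_zero hfin] at h0
      exact no_two' G hc hreg v v S (by simp [h0]) hS
    · obtain ⟨a, rfl⟩ := Set.ncard_eq_one.1 h1
      exact no_two' G hc hreg a a _ (by simp) hS
    · obtain ⟨a, b, _, rfl⟩ := Set.ncard_eq_two.1 h2
      exact no_two' G hc hreg a b _ subset_rfl hS
end

section
/- For n ∈ {5, 6, 7, 9}, the edge metric dimension of GP(n,2) equals 4. -/
open SimpleGraph

abbrev PV (n : ℕ) := Fin n ⊕ Fin n

/-- the three families of edges of `GP n 2` -/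
def pedge (n : ℕ) [NeZero n] (k : Fin 3) (i : Fin n) : PV n × PV n :=
  match k with
  | 0 => (Sum.inl i, Sum.inl (Fin.ofNat n (i.val + 1)))
  | 1 => (Sum.inl i, Sum.inr i)
  | 2 => (Sum.inr i, Sum.inr (Fin.ofNat n (i.val + 2)))

def pdist (n : ℕ) (duu duv dvv : List ℕ) : PV n → PV n → ℕ
  | Sum.inl i, Sum.inl j => duu.getD ((j.val + n - i.val) % n) 0
  | Sum.inl i, Sum.inr j => duv.getD ((j.val + n - i.val) % n) 0
  | Sum.inr i, Sum.inl j => duv.getD ((i.val + n - j.val) % n) 0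
  | Sum.inr i, Sum.inr j => dvv.getD ((j.val + n - i.val) % n) 0

def pcode (n : ℕ) (T : List ℕ) : PV n → ℕ
  | Sum.inl i => T.getD i.val 0
  | Sum.inr i => T.getD (n + i.val) 0

lemma adj_iff_pedge (n : ℕ) [NeZero n]
    (hne : ∀ k i, (pedge n k i).1 ≠ (pedge n k i).2) (x y : PV n) :
    (GP n 2).Adj x y ↔ ∃ k i, pedge n k i = (x, y) ∨ pedge n k i = (y, x) := by
  constructor
  · intro h
    rw [GP, SimpleGraph.fromRel_adj] at h
    obtain ⟨_, h⟩ := h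
    rcases x with i | i <;> rcases y with j | j <;> simp only [or_false, false_or] at h
    · rcases h with h | h
      · exact ⟨0, i, Or.inl (by simp [pedge, Fin.ext_iff, h])⟩
      · exact ⟨0, j, Or.inr (by simp [pedge, Fin.ext_iff, h])⟩
    · exact ⟨1, i, Or.inl (by simp [pedge, h])⟩
    · exact ⟨1, j, Or.inr (by simp [pedge, h])⟩
    · rcases h with h | h
      · exact ⟨2, i, Or.inl (by simp [pedge, Fin.ext_iff, h])⟩
      · exact ⟨2, j, Or.inr (by simp [pedge, Fin.ext_iff, h])⟩
  · rintro ⟨k, i, h⟩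
    have key : (GP n 2).Adj (pedge n k i).1 (pedge n k i).2 := by
      rw [GP, SimpleGraph.fromRel_adj]
      refine ⟨hne k i, Or.inl ?_⟩
      fin_cases k <;> simp [pedge]
    rcases h with h | h
    · rw [h] at key; exact key
    · rw [h] at key; exact key.symm

lemma dist_eq_of_check {V : Type*} (G : SimpleGraph V) (d : V → V → ℕ)
    (h0 : ∀ w, d w w = 0)
    (hL : ∀ w x y, G.Adj x y → d w y ≤ d w x + 1)
    (hP : ∀ w x, x = w ∨ ∃ y, G.Adj y x ∧ d w x = d w y + 1) (w x : V) :
    G.dist w x = d w x := by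
  have hw : ∀ m w x, d w x = m → ∃ p : G.Walk w x, p.length = m := by
    intro m
    induction m with
    | zero =>
      intro w x h
      rcases hP w x with rfl | ⟨y, _, h2⟩
      · exact ⟨SimpleGraph.Walk.nil, rfl⟩
      · omega
    | succ m ih =>
      intro w x h
      rcases hP w x with rfl | ⟨y, h1, h2⟩
      · rw [h0] at h; omega
      · obtain ⟨p, hp⟩ := ih w y (by omega)
        exact ⟨p.concat h1, by simp [hp]⟩
  have hle : ∀ (a b : V) (p : G.Walk a b), ∀ w, d w b ≤ d w a + p.length := by
    intro a b p
    induction p with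
    | nil => intro w; simp
    | cons h p ih =>
      intro w
      have h1 := ih w
      have h2 := hL w _ _ h
      simp only [SimpleGraph.Walk.length_cons]
      omega
  obtain ⟨p, hp⟩ := hw _ w x rfl
  apply le_antisymm
  · rw [← hp]; exact SimpleGraph.dist_le p
  · obtain ⟨q, hq⟩ := (SimpleGraph.Walk.reachable p).exists_walk_length_eq_dist
    have := hle w x q w
    rw [h0] at this
    omega

def pedist (n : ℕ) [NeZero n] (duu duv dvv : List ℕ) (w : PV n) (e : Fin 3 × Fin n) : ℕ :=
  min (pdist n duu duv dvv w (pedge n e.1 e.2).1) (pdist n duu duv dvv w (pedge n e.1 e.2).2)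

lemma main_check (n : ℕ) [NeZero n] (duu duv dvv T : List ℕ)
    (P : List ((Fin 3 × Fin n) × (Fin 3 × Fin n))) (S : Finset (PV n))
    (hn : 3 ≤ n)
    (hne : ∀ k i, (pedge n k i).1 ≠ (pedge n k i).2)
    (h0 : ∀ w, pdist n duu duv dvv w w = 0)
    (hL : ∀ w k i,
      pdist n duu duv dvv w (pedge n k i).1 ≤ pdist n duu duv dvv w (pedge n k i).2 + 1 ∧
      pdist n duu duv dvv w (pedge n k i).2 ≤ pdist n duu duv dvv w (pedge n k i).1 + 1)
    (hP : ∀ w x, x = w ∨ ∃ k i,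
      (x = (pedge n k i).1 ∧
        pdist n duu duv dvv w x = pdist n duu duv dvv w (pedge n k i).2 + 1) ∨
      (x = (pedge n k i).2 ∧
        pdist n duu duv dvv w x = pdist n duu duv dvv w (pedge n k i).1 + 1))
    (hS : S.card = 4)
    (hgen : ∀ k i k' i', (∀ w ∈ S, pedist n duu duv dvv w (k, i) = pedist n duu duv dvv w (k', i'))
      → k = k' ∧ i = i')
    (hPne : ∀ p ∈ P, s((pedge n p.1.1 p.1.2).1, (pedge n p.1.1 p.1.2).2) ≠
      s((pedge n p.2.1 p.2.2).1, (pedge n p.2.1 p.2.2).2))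
    (hTlt : ∀ w, pcode n T w < 2 ^ P.length)
    (hT : ∀ w, ∀ i : Fin P.length, (pcode n T w).testBit i.val = true ∨
      pedist n duu duv dvv w (P[i]).1 = pedist n duu duv dvv w (P[i]).2)
    (hcov : ∀ a b c, pcode n T a ||| pcode n T b ||| pcode n T c ≠ 2 ^ P.length - 1) :
    edgeMetricDim (GP n 2) = 4 := by
  have hadj := adj_iff_pedge n hne
  have hd : ∀ w x, (GP n 2).dist w x = pdist n duu duv dvv w x := by
    apply dist_eq_of_check _ _ h0
    · intro w x y h
      obtain ⟨k, i, h | h⟩ := (hadj x y).1 h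
      · have := (hL w k i).2
        rw [h] at this; exact this
      · have := (hL w k i).1
        rw [h] at this; exact this
    · intro w x
      rcases hP w x with h | ⟨k, i, ⟨h1, h2⟩ | ⟨h1, h2⟩⟩
      · exact Or.inl h
      · exact Or.inr ⟨_, (hadj _ _).2 ⟨k, i, Or.inr (by rw [h1])⟩, h2⟩
      · exact Or.inr ⟨_, (hadj _ _).2 ⟨k, i, Or.inl (by rw [h1])⟩, h2⟩
  have hed : ∀ w (e : Fin 3 × Fin n),
      edgeDist (GP n 2) w s((pedge n e.1 e.2).1, (pedge n e.1 e.2).2)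
        = pedist n duu duv dvv w e := by
    intro w e
    simp only [edgeDist, Sym2.lift_mk, hd, pedist]
  have hedge : ∀ e ∈ (GP n 2).edgeSet, ∃ k i, e = s((pedge n k i).1, (pedge n k i).2) := by
    intro e
    induction e using Sym2.ind with
    | _ x y =>
      intro h
      obtain ⟨k, i, h | h⟩ := (hadj x y).1 h
      · exact ⟨k, i, by rw [h]⟩
      · exact ⟨k, i, by rw [h]; exact Sym2.eq_swap⟩
  have hmem : ∀ k i, s((pedge n k i).1, (pedge n k i).2) ∈ (GP n 2).edgeSet :=
    fun k i => (hadj _ _).2 ⟨k, i, Or.inl rfl⟩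
  apply le_antisymm
  · apply Nat.sInf_le
    refine ⟨(S : Set (PV n)), S.finite_toSet, by rw [Set.ncard_coe_finset, hS], ?_⟩
    intro e₁ h₁ e₂ h₂ h
    obtain ⟨k, i, rfl⟩ := hedge _ h₁
    obtain ⟨k', i', rfl⟩ := hedge _ h₂
    obtain ⟨rfl, rfl⟩ := hgen k i k' i' (fun w hw => by
      rw [← hed, ← hed]; exact h w (by exact_mod_cast hw))
    rfl
  · apply le_csInf
    · exact ⟨4, (S : Set (PV n)), S.finite_toSet, by rw [Set.ncard_coe_finset, hS], by
        intro e₁ h₁ e₂ h₂ h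
        obtain ⟨k, i, rfl⟩ := hedge _ h₁
        obtain ⟨k', i', rfl⟩ := hedge _ h₂
        obtain ⟨rfl, rfl⟩ := hgen k i k' i' (fun w hw => by
          rw [← hed, ← hed]; exact h w (by exact_mod_cast hw))
        rfl⟩
    · rintro m ⟨R, hR, rfl, hRg⟩
      by_contra hlt
      push Not at hlt
      have hcard : hR.toFinset.card ≤ 3 := by
        rw [← Set.ncard_eq_toFinset_card R hR]; omega
      obtain ⟨R', hsub, hR'⟩ := Finset.exists_superset_card_eq hcard
        (by simp only [Fintype.card_sum, Fintype.card_fin]; omega)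
      obtain ⟨a, b, c, _, _, _, rfl⟩ := Finset.card_eq_three.1 hR'
      apply hcov a b c
      apply Nat.eq_of_testBit_eq
      intro i
      rw [Nat.testBit_two_pow_sub_one]
      by_cases hi : i < P.length
      · simp only [hi, decide_true]
        by_contra hbit
        simp only [Nat.testBit_or, Bool.or_eq_true, not_or] at hbit
        obtain ⟨⟨ha, hb⟩, hc⟩ := hbit
        have ea := (hT a ⟨i, hi⟩).resolve_left ha
        have eb := (hT b ⟨i, hi⟩).resolve_left hb
        have ec := (hT c ⟨i, hi⟩).resolve_left hc
        apply hPne (P[i]) (List.getElem_mem hi)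
        apply hRg _ (hmem _ _) _ (hmem _ _)
        intro w hw
        rw [hed, hed]
        have : w ∈ ({a, b, c} : Finset (PV n)) := hsub (by simpa using hw)
        simp only [Finset.mem_insert, Finset.mem_singleton] at this
        rcases this with rfl | rfl | rfl
        · exact ea
        · exact eb
        · exact ec
      · simp only [hi, decide_false]
        apply Nat.testBit_lt_two_pow
        refine lt_of_lt_of_le ?_ (Nat.pow_le_pow_right (by norm_num) (not_lt.1 hi))
        exact Nat.or_lt_two_pow (Nat.or_lt_two_pow (hTlt a) (hTlt b)) (hTlt c)

lemma gp_5 : edgeMetricDim (GP 5 2) = 4 := by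
  refine main_check 5 [0, 1, 2, 2, 1] [1, 2, 2, 2, 2] [0, 2, 1, 1, 2]
    [3113, 1866, 613, 5251, 2290, 913, 2310, 4524, 7700, 4184]
    [((1, 0), (0, 2)), ((1, 1), (0, 3)), ((2, 1), (1, 2)), ((2, 2), (0, 0)), ((2, 3), (1, 4)),
    ((1, 2), (0, 4)), ((1, 4), (0, 1)), ((2, 0), (0, 3)), ((2, 0), (1, 1)), ((2, 3), (0, 1)),
    ((1, 3), (0, 0)), ((2, 1), (0, 4)), ((2, 2), (1, 3))]
    {.inl 0, .inl 1, .inl 3, .inr 3} ?_ ?_ ?_ ?_ ?_ ?_ ?_ ?_ ?_ ?_ ?_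
  all_goals decide +kernel

lemma gp_6 : edgeMetricDim (GP 6 2) = 4 := by
  refine main_check 6 [0, 1, 2, 3, 2, 1] [1, 2, 2, 3, 2, 2] [0, 3, 1, 4, 1, 3]
    [9, 34, 12, 48, 5, 18, 9, 34, 12, 48, 5, 18]
    [((2, 2), (2, 0)), ((2, 3), (2, 1)), ((2, 4), (2, 0)), ((2, 4), (2, 2)), ((2, 5), (2, 1)),
    ((2, 5), (2, 3))]
    {.inl 0, .inl 1, .inl 2, .inl 3} ?_ ?_ ?_ ?_ ?_ ?_ ?_ ?_ ?_ ?_ ?_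
  all_goals decide +kernel

lemma gp_7 : edgeMetricDim (GP 7 2) = 4 := by
  refine main_check 7 [0, 1, 2, 3, 3, 2, 1] [1, 2, 2, 3, 3, 2, 2] [0, 3, 1, 2, 2, 1, 3]
    [728281315039525179276, 1016283408225360742313, 1124051130211198965481,
    797497279685685294833, 430899329715723992786, 1126375004974902470294,
    847217081321812641670, 1159423219217957874151, 1048364489917458209117,
    238004925763227595195, 805292410448769153646, 341088401455232380277, 368688775512014314331,
    589248353811184204862]
    [((1, 0), (0, 0)), ((1, 0), (0, 6)), ((1, 1), (0, 0)), ((1, 3), (0, 2)), ((1, 6), (0, 5)),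
    ((1, 4), (0, 3)), ((1, 5), (0, 4)), ((2, 0), (0, 4)), ((1, 2), (0, 1)), ((2, 3), (0, 0)),
    ((2, 4), (0, 1)), ((2, 2), (2, 0)), ((1, 1), (0, 1)), ((1, 2), (0, 2)), ((1, 3), (0, 3)),
    ((1, 4), (0, 4)), ((1, 5), (0, 5)), ((1, 6), (0, 3)), ((2, 0), (1, 0)), ((2, 0), (1, 2)),
    ((2, 3), (1, 6)), ((2, 2), (1, 1)), ((2, 2), (1, 5)), ((2, 3), (1, 5)), ((2, 4), (1, 4)),
    ((2, 5), (1, 1)), ((1, 3), (0, 5)), ((2, 1), (1, 1)), ((2, 2), (0, 0)), ((2, 4), (1, 6)),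
    ((2, 5), (0, 1)), ((2, 6), (1, 1)), ((1, 1), (0, 3)), ((1, 1), (0, 5)), ((1, 3), (0, 0)),
    ((2, 0), (0, 3)), ((2, 0), (0, 5)), ((2, 2), (0, 5)), ((2, 4), (0, 0)), ((2, 6), (2, 1)),
    ((1, 4), (0, 1)), ((1, 5), (0, 2)), ((2, 3), (0, 6)), ((2, 5), (2, 3)), ((1, 3), (1, 0)),
    ((1, 4), (1, 0)), ((1, 4), (1, 1)), ((1, 5), (1, 1)), ((1, 5), (1, 2)), ((1, 6), (1, 2)),
    ((1, 6), (1, 3)), ((2, 0), (1, 3)), ((2, 0), (1, 6)), ((2, 1), (1, 0)), ((2, 1), (1, 3)),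
    ((2, 1), (1, 4)), ((2, 2), (1, 2)), ((2, 2), (1, 4)), ((2, 3), (1, 2)), ((2, 3), (1, 3)),
    ((2, 4), (1, 0)), ((2, 4), (1, 3)), ((2, 4), (2, 0)), ((2, 4), (2, 2)), ((2, 5), (1, 0)),
    ((2, 5), (1, 4)), ((2, 5), (1, 5)), ((2, 6), (1, 2)), ((2, 6), (1, 5)), ((2, 6), (1, 6))]
    {.inl 0, .inl 1, .inl 4, .inr 2} ?_ ?_ ?_ ?_ ?_ ?_ ?_ ?_ ?_ ?_ ?_
  all_goals decide +kernel

lemma gp_9 : edgeMetricDim (GP 9 2) = 4 := by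
  refine main_check 9 [0, 1, 2, 3, 4, 4, 3, 2, 1] [1, 2, 2, 3, 3, 3, 3, 2, 2] [0, 3, 1, 3, 2, 2, 3, 1, 3]
    [150894195357117831919162, 150230270185552468520681, 147573627155507496011164,
    127503822332793514832314, 66113112521413320649073, 113335489394221610755004,
    151112839517215735355306, 151101520002118212792281, 151060305866533165786804,
    148417718145294625535347, 130879496849134309923563, 70171083571551166979463,
    139013000641201883560599, 93263979535713880747367, 70825494430736391990094,
    141628024389904459717838, 113168167658870693649245, 150441789978778713577077]
    [((2, 0), (1, 1)), ((2, 2), (1, 3)), ((2, 4), (1, 5)), ((1, 7), (0, 0)), ((1, 0), (0, 2)),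
    ((1, 1), (0, 3)), ((2, 6), (1, 7)), ((1, 3), (0, 5)), ((2, 3), (1, 3)), ((2, 6), (1, 6)),
    ((2, 7), (1, 7)), ((2, 3), (1, 4)), ((2, 8), (1, 0)), ((1, 3), (0, 0)), ((2, 7), (1, 8)),
    ((2, 1), (1, 2)), ((2, 5), (1, 6)), ((1, 4), (0, 6)), ((2, 0), (1, 0)), ((1, 0), (0, 6)),
    ((2, 4), (1, 4)), ((2, 1), (1, 1)), ((1, 6), (0, 3)), ((1, 6), (0, 8)), ((2, 0), (1, 2)),
    ((2, 2), (1, 2)), ((2, 5), (1, 5)), ((1, 2), (0, 4)), ((1, 2), (0, 8)), ((1, 5), (0, 2)),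
    ((2, 5), (0, 8)), ((1, 0), (0, 0)), ((1, 0), (0, 8)), ((1, 1), (0, 0)), ((1, 2), (0, 1)),
    ((1, 4), (0, 3)), ((1, 5), (0, 4)), ((1, 6), (0, 5)), ((2, 0), (0, 7)), ((2, 1), (0, 4)),
    ((2, 4), (0, 7)), ((2, 7), (0, 1)), ((1, 4), (0, 4)), ((1, 5), (0, 5)), ((1, 7), (1, 2)),
    ((2, 0), (0, 3)), ((2, 2), (0, 5)), ((2, 3), (0, 6)), ((2, 6), (0, 0)), ((1, 4), (0, 1)),
    ((1, 5), (0, 7)), ((1, 5), (1, 0)), ((1, 7), (0, 4)), ((1, 1), (0, 1)), ((1, 1), (0, 7)),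
    ((1, 4), (1, 0)), ((1, 4), (1, 2)), ((1, 8), (0, 1)), ((1, 8), (0, 5)), ((2, 0), (0, 2)),
    ((2, 0), (0, 8)), ((2, 1), (0, 0)), ((2, 1), (0, 3)), ((2, 2), (0, 1)), ((2, 2), (0, 4)),
    ((2, 3), (0, 2)), ((2, 3), (0, 5)), ((2, 4), (0, 3)), ((2, 4), (0, 6)), ((2, 5), (0, 4)),
    ((2, 5), (0, 7)), ((2, 6), (0, 5)), ((2, 6), (0, 8)), ((2, 7), (0, 0)), ((2, 7), (0, 6)),
    ((2, 8), (0, 1)), ((2, 8), (0, 7))]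
    {.inl 0, .inl 1, .inl 2, .inr 5} ?_ ?_ ?_ ?_ ?_ ?_ ?_ ?_ ?_ ?_ ?_
  all_goals decide +kernel

/-- For `n ∈ {5,6,7,9}`, `β_E(GP(n,2)) = 4`. -/
theorem stmt9 (n : ℕ) (hn : n ∈ ({5, 6, 7, 9} : Set ℕ)) :
    edgeMetricDim (GP n 2) = 4 := by
  simp only [Set.mem_insert_iff, Set.mem_singleton_iff] at hn
  rcases hn with rfl | rfl | rfl | rfl
  · exact gp_5
  · exact gp_6
  · exact gp_7
  · exact gp_9
end

section
/- For n = 8 and all n ≥ 10, the edge metric dimension of GP(n,2) equals 3. -/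
open SimpleGraph

def fvv (k : ℕ) : ℕ := k / 2 + 3 * (k % 2)
def fuv (k : ℕ) : ℕ := 1 + (k + 1) / 2
def fuu (k : ℕ) : ℕ := min k (2 + (k + 1) / 2)
def rel (n a i : ℕ) : ℕ := if a ≤ i then i - a else i + n - a
/-- distance from `v_a` -/
def dvu (n a i : ℕ) : ℕ := min (fuv (rel n a i)) (fuv (n - rel n a i))
def dvv (n a i : ℕ) : ℕ := min (fvv (rel n a i)) (fvv (n - rel n a i))
def duu (n a i : ℕ) : ℕ := min (fuu (rel n a i)) (fuu (n - rel n a i))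
def nx (n i k : ℕ) : ℕ := if i + k < n then i + k else i + k - n
def code (n t : ℕ) (T i : ℕ) : ℕ × ℕ × ℕ :=
  match T with
  | 0 => (min (dvu n 0 i) (dvu n 0 (nx n i 1)), min (dvu n 1 i) (dvu n 1 (nx n i 1)),
      min (duu n t i) (duu n t (nx n i 1)))
  | 1 => (min (dvu n 0 i) (dvv n 0 i), min (dvu n 1 i) (dvv n 1 i),
      min (duu n t i) (dvu n t i))
  | _ => (min (dvv n 0 i) (dvv n 0 (nx n i 2)), min (dvv n 1 i) (dvv n 1 (nx n i 2)),
      min (dvu n t i) (dvu n t (nx n i 2)))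
def good1 (n t T i : ℕ) : Prop := ∀ T' < 3, ∀ j < n, code n t T i = code n t T' j → T = T' ∧ i = j
instance (n t T i : ℕ) : Decidable (good1 n t T i) := by unfold good1; infer_instance
def good (n t : ℕ) : Prop := ∀ T < 3, ∀ i < n, good1 n t T i
instance (n t : ℕ) : Decidable (good n t) := by unfold good; infer_instance
def tt (n : ℕ) : ℕ := if n = 8 then 3 else 2 * ((n+2)/4) - 2

set_option linter.all false

def F0 (q s : ℤ) : ℕ → ℕ → ℤ × ℤ × ℤ
  | 0, 0 =>
    if s + 3 ≤ q then (s + 1, s + 1, q - s + 2)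
    else if s + 1 ≤ q then (s + 1, s + 1, 2 * q - 2 * s - 1)
    else if s ≤ q + 1 then (q + 1, q + 1, 2 * s - 2 * q)
    else (2 * q - s + 2, 2 * q - s + 2, s - q + 2)
  | 0, _ =>
    if s + 3 ≤ q then (s + 2, s + 1, q - s + 1)
    else if s + 1 ≤ q then (s + 2, s + 1, 2 * q - 2 * s - 2)
    else if s ≤ q + 1 then (2 * q - s + 1, q + 1, 2 * s - 2 * q + 1)
    else if s + 1 ≤ 2 * q then (2 * q - s + 1, 2 * q - s + 2, s - q + 3)
    else (1, 2, q + 2)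
  | 1, 0 =>
    if s ≤ 1 then (s, 2, q - s + 1)
    else if s + 1 ≤ q then (s, s + 1, q - s + 1)
    else if s ≤ q + 1 then (q, s + 1, 2 * s - 2 * q)
    else (2 * q - s + 1, 2 * q - s + 3, s - q + 1)
  | 1, _ =>
    if s + 2 ≤ q then (s + 2, s, q - s + 1)
    else if s ≤ q then (s + 2, s, 1)
    else (2 * q - s + 2, 2 * q - s + 1, s - q + 2)
  | _, 0 =>
    if s ≤ 1 then (s, 3, q - s)
    else if s + 1 ≤ q then (s, s + 2, q - s)
    else if s ≤ q + 1 then (2 * q - s, q + 2, s - q + 1)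
    else (2 * q - s, 2 * q - s + 3, s - q + 1)
  | _, _ =>
    if s + 2 ≤ q then (s + 3, s, q - s)
    else if s ≤ q then (q + 2, s, 2)
    else if s + 1 ≤ 2 * q then (2 * q - s + 2, 2 * q - s, s - q + 2)
    else (3, 0, q + 1)

def F1 (q s : ℤ) : ℕ → ℕ → ℤ × ℤ × ℤ
  | 0, 0 =>
    if s + 3 ≤ q then (s + 1, s + 1, q - s + 2)
    else if s + 1 ≤ q then (s + 1, s + 1, 2 * q - 2 * s - 1)
    else if s ≤ q + 1 then (q + 1, s + 1, 2 * s - 2 * q)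
    else if s ≤ 2 * q then (2 * q - s + 2, 2 * q - s + 3, s - q + 2)
    else (1, 2, q + 2)
  | 0, _ =>
    if s + 3 ≤ q then (s + 2, s + 1, q - s + 1)
    else if s + 1 ≤ q then (s + 2, s + 1, 2 * q - 2 * s - 2)
    else if s ≤ q + 1 then (2 * q - s + 2, q + 1, 2 * s - 2 * q + 1)
    else (2 * q - s + 2, 2 * q - s + 2, s - q + 3)
  | 1, 0 =>
    if s ≤ 1 then (s, 2, q - s + 1)
    else if s + 1 ≤ q then (s, s + 1, q - s + 1)
    else if s ≤ q + 1 then (s, q + 1, 2 * s - 2 * q)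
    else (2 * q - s + 3, 2 * q - s + 2, s - q + 1)
  | 1, _ =>
    if s + 2 ≤ q then (s + 2, s, q - s + 1)
    else if s ≤ q then (q + 1, s, 1)
    else if s ≤ q + 2 then (2 * q - s + 1, q + 1, s - q + 2)
    else (2 * q - s + 1, 2 * q - s + 3, s - q + 2)
  | _, 0 =>
    if s ≤ 1 then (s, 3, q - s)
    else if s + 1 ≤ q then (s, s + 2, q - s)
    else if s ≤ q + 1 then (s, 2 * q - s + 1, s - q + 1)
    else if s ≤ 2 * q then (2 * q - s + 3, 2 * q - s + 1, s - q + 1)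
    else (3, 0, q + 1)
  | _, _ =>
    if s + 2 ≤ q then (s + 3, s, q - s)
    else if s ≤ q then (2 * q - s, s, 2)
    else if s ≤ q + 2 then (2 * q - s, q + 1, s - q + 2)
    else if s + 1 ≤ 2 * q then (2 * q - s, 2 * q - s + 3, s - q + 2)
    else (0, 3, q + 1)

def F2 (q s : ℤ) : ℕ → ℕ → ℤ × ℤ × ℤ
  | 0, 0 =>
    if s + 3 ≤ q then (s + 1, s + 1, q - s + 2)
    else if s + 1 ≤ q then (s + 1, s + 1, 2 * q - 2 * s - 1)
    else if s ≤ q + 1 then (s + 1, s + 1, 2 * s - 2 * q)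
    else (2 * q - s + 3, 2 * q - s + 3, s - q + 2)
  | 0, _ =>
    if s + 3 ≤ q then (s + 2, s + 1, q - s + 1)
    else if s + 1 ≤ q then (s + 2, s + 1, 2 * q - 2 * s - 2)
    else if s ≤ q + 1 then (2 * q - s + 2, s + 1, 2 * s - 2 * q + 1)
    else if s ≤ 2 * q then (2 * q - s + 2, 2 * q - s + 3, s - q + 3)
    else (1, 2, q + 2)
  | 1, 0 =>
    if s ≤ 1 then (s, 2, q - s + 1)
    else if s + 1 ≤ q then (s, s + 1, q - s + 1)
    else if s ≤ q + 1 then (s, s + 1, 2 * s - 2 * q)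
    else (2 * q - s + 2, 2 * q - s + 4, s - q + 1)
  | 1, _ =>
    if s + 2 ≤ q then (s + 2, s, q - s + 1)
    else if s ≤ q then (s + 2, s, 1)
    else if s ≤ 2 * q then (2 * q - s + 3, 2 * q - s + 2, s - q + 2)
    else (2, 1, q + 2)
  | _, 0 =>
    if s ≤ 1 then (s, 3, q - s)
    else if s + 1 ≤ q then (s, s + 2, q - s)
    else if s ≤ q + 1 then (q, s + 2, s - q + 1)
    else if s ≤ 2 * q then (2 * q - s + 1, 2 * q - s + 4, s - q + 1)
    else (0, 3, q + 1)
  | _, _ =>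
    if s + 2 ≤ q then (s + 3, s, q - s)
    else if s ≤ q then (s + 3, s, 2)
    else if s ≤ 2 * q then (2 * q - s + 3, 2 * q - s + 1, s - q + 2)
    else (3, 0, q + 1)

def F3 (q s : ℤ) : ℕ → ℕ → ℤ × ℤ × ℤ
  | 0, 0 =>
    if s + 3 ≤ q then (s + 1, s + 1, q - s + 2)
    else if s + 1 ≤ q then (s + 1, s + 1, 2 * q - 2 * s - 1)
    else if s ≤ q + 1 then (s + 1, s + 1, 2 * s - 2 * q)
    else if s ≤ 2 * q + 1 then (2 * q - s + 3, 2 * q - s + 4, s - q + 2)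
    else (1, 2, q + 2)
  | 0, _ =>
    if s + 3 ≤ q then (s + 2, s + 1, q - s + 1)
    else if s + 1 ≤ q then (s + 2, s + 1, 2 * q - 2 * s - 2)
    else if s ≤ q + 1 then (q + 2, s + 1, 2 * s - 2 * q + 1)
    else if s ≤ 2 * q then (2 * q - s + 3, 2 * q - s + 3, s - q + 3)
    else (2, 2, q + 3)
  | 1, 0 =>
    if s ≤ 1 then (s, 2, q - s + 1)
    else if s + 1 ≤ q then (s, s + 1, q - s + 1)
    else if s ≤ q + 1 then (s, s + 1, 2 * s - 2 * q)
    else if s ≤ 2 * q + 1 then (2 * q - s + 4, 2 * q - s + 3, s - q + 1)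
    else (2, 1, q + 2)
  | 1, _ =>
    if s + 2 ≤ q then (s + 2, s, q - s + 1)
    else if s ≤ q then (s + 2, s, 1)
    else if s ≤ q + 2 then (2 * q - s + 2, s, s - q + 2)
    else if s ≤ 2 * q then (2 * q - s + 2, 2 * q - s + 4, s - q + 2)
    else (1, 3, q + 2)
  | _, 0 =>
    if s ≤ 1 then (s, 3, q - s)
    else if s + 1 ≤ q then (s, s + 2, q - s)
    else if s ≤ q + 2 then (s, 2 * q - s + 2, s - q + 1)
    else if s ≤ 2 * q + 1 then (2 * q - s + 4, 2 * q - s + 2, s - q + 1)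
    else (3, 0, q + 1)
  | _, _ =>
    if s + 2 ≤ q then (s + 3, s, q - s)
    else if s ≤ q then (2 * q - s + 1, s, 2)
    else if s ≤ q + 2 then (2 * q - s + 1, s, s - q + 2)
    else if s ≤ 2 * q then (2 * q - s + 1, 2 * q - s + 4, s - q + 2)
    else (0, 3, q + 1)

/-- closed forms of edge distances from an inner vertex -/
def eV (n T j : ℕ) : ℕ :=
  match T with
  | 0 => min (fuv j) (fuv (n - 1 - j))
  | 1 => min (j / 2 + 2 * (j % 2)) ((n - j) / 2 + 2 * ((n - j) % 2))
  | _ => if j + 2 ≤ n then min (fvv j) (fvv (n - 2 - j)) else 3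

def eU (n T j : ℕ) : ℕ :=
  match T with
  | 0 => min (fuu j) (fuu (n - 1 - j))
  | 1 => min (min j (1 + (j + 1) / 2)) (min (n - j) (1 + (n - j + 1) / 2))
  | _ => if j + 2 ≤ n then min (fuv j) (fuv (n - 2 - j)) else 2

theorem rel_lt (n a i : ℕ) (ha : a < n) (hi : i < n) : rel n a i < n := by
  unfold rel; split_ifs <;> omega

theorem rel_nx (n a i k : ℕ) (hk : k < n) (ha : a < n) (hi : i < n) :
    rel n a (nx n i k) = nx n (rel n a i) k := by
  unfold rel nx; split_ifs <;> omega

theorem mm {a b c d x y : ℕ} (h1 : a ≤ c) (h2 : d ≤ b) (ha : a = x) (hd : d = y) :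
    min (min a b) (min c d) = min x y := by omega

theorem fuv_mono {a b : ℕ} (h : a ≤ b) : fuv a ≤ fuv b := by unfold fuv; omega
theorem fuu_mono {a b : ℕ} (h : a ≤ b) : fuu a ≤ fuu b := by unfold fuu; omega
theorem fvv_mono {a b : ℕ} (h : b = a + 2) : fvv a ≤ fvv b := by unfold fvv; omega

theorem eO (f : ℕ → ℕ) (hf : ∀ a b, a ≤ b → f a ≤ f b) (n j : ℕ) (hn : 5 ≤ n) (hj : j < n) :
    min (min (f j) (f (n - j))) (min (f (nx n j 1)) (f (n - nx n j 1)))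
      = min (f j) (f (n - 1 - j)) := by
  unfold nx
  split_ifs with h
  · exact mm (hf _ _ (by omega)) (hf _ _ (by omega)) rfl (by congr 1; omega)
  · have e : j = n - 1 := by omega
    subst e
    have h1 : n - (n - 1) = 1 := by omega
    have h2 : n - 1 + 1 - n = 0 := by omega
    have h3 : n - 1 - (n - 1) = 0 := by omega
    rw [h1, h2, h3]
    have := hf 0 1 (by omega)
    have := hf 0 (n - 1) (by omega)
    have := hf 0 (n - 0) (by omega)
    omega

theorem eI (f : ℕ → ℕ) (hf : ∀ a, f a ≤ f (a + 2))
    (hf2 : ∀ a, 7 ≤ a → f 1 ≤ f a)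
    (n j : ℕ) (hn : 8 ≤ n) (hj : j < n) :
    min (min (f j) (f (n - j))) (min (f (nx n j 2)) (f (n - nx n j 2)))
      = if j + 2 ≤ n then min (f j) (f (n - 2 - j)) else f 1 := by
  unfold nx
  split_ifs with h h' h'
  · have := hf j
    have := hf (n - 2 - j)
    rw [show n - 2 - j + 2 = n - j by omega] at this
    rw [show n - (j + 2) = n - 2 - j by omega]
    exact mm ‹_› ‹_› rfl rfl
  · omega
  · have e : j = n - 2 := by omega
    subst e
    have h1 : n - (n - 2) = 2 := by omega
    have h2 : n - 2 + 2 - n = 0 := by omega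
    have h3 : n - 2 - (n - 2) = 0 := by omega
    rw [h1, h2, h3]
    have := hf 0
    have := hf (n - 2)
    rw [show n - 2 + 2 = n by omega] at this
    simp only [Nat.sub_zero]
    simp only [Nat.zero_add] at *
    omega
  · have e : j = n - 1 := by omega
    subst e
    have h1 : n - (n - 1) = 1 := by omega
    have h2 : n - 1 + 2 - n = 1 := by omega
    rw [h1, h2]
    have := hf2 (n - 1) (by omega)
    omega

theorem code_eq (n t T i : ℕ) (hT : T < 3) (hn : 8 ≤ n) (ht : t < n) (hi : i < n) :
    code n t T i = (eV n T i, eV n T (rel n 1 i), eU n T (rel n t i)) := by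
  have h0 : rel n 0 i = i := by unfold rel; simp
  have hj1 := rel_lt n 1 i (by omega) hi
  have hjt := rel_lt n t i ht hi
  have r1 := fun a (ha : a < n) => rel_nx n a i 1 (by omega) ha hi
  have r2 := fun a (ha : a < n) => rel_nx n a i 2 (by omega) ha hi
  have F1 := eO fuv (fun a b => fuv_mono) n
  have F2 := eO fuu (fun a b => fuu_mono) n
  have F3 := eI fvv (fun a => fvv_mono rfl)
    (by intro a; unfold fvv; omega) n
  have F4 := eI fuv (fun a => fuv_mono (by omega))
    (by intro a; unfold fuv; omega) n
  have c1 : fvv 1 = 3 := rfl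
  have c2 : fuv 1 = 2 := rfl
  rw [c1] at F3
  rw [c2] at F4
  have G1 : ∀ j, min (min (fuv j) (fuv (n - j))) (min (fvv j) (fvv (n - j))) =
      min (j / 2 + 2 * (j % 2)) ((n - j) / 2 + 2 * ((n - j) % 2)) := by
    intro j; generalize n - j = k; unfold fuv fvv; omega
  have G2 : ∀ j, min (min (fuu j) (fuu (n - j))) (min (fuv j) (fuv (n - j))) =
      min (min j (1 + (j + 1) / 2)) (min (n - j) (1 + (n - j + 1) / 2)) := by
    intro j; generalize n - j = k; unfold fuv fuu; omega
  interval_cases T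
  · simp only [code, dvu, duu, eV, eU]
    rw [r1 0 (by omega), r1 1 (by omega), r1 t ht, h0, F1 i (by omega) hi, F1 _ (by omega) hj1,
      F2 _ (by omega) hjt]
  · simp only [code, dvu, dvv, duu, eV, eU]
    rw [h0, G1, G1, G2]
  · simp only [code, dvu, dvv, eV, eU]
    rw [r2 0 (by omega), r2 1 (by omega), r2 t ht, h0, F3 i hn hi, F3 _ hn hj1,
      F4 _ hn hjt]

set_option maxHeartbeats 4000000 in
theorem F0_spec (q T e s : ℕ) (hq : 3 ≤ q) (hT : T < 3) (he : e < 2)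
    (hi : 2 * s + e < 4 * q + 2) :
    (((eV (4 * q + 2) T (2 * s + e) : ℕ) : ℤ),
      ((eV (4 * q + 2) T (rel (4 * q + 2) 1 (2 * s + e)) : ℕ) : ℤ),
      ((eU (4 * q + 2) T (rel (4 * q + 2) (2 * q) (2 * s + e)) : ℕ) : ℤ)) =
        F0 q s T e := by
  interval_cases T <;> interval_cases e <;> simp only [F0] <;> split_ifs <;>
    simp only [Prod.mk.injEq, eV, eU, rel] <;> refine ⟨?_, ?_, ?_⟩ <;>
    (try simp (disch := omega) only [if_pos, if_neg, min_eq_left, min_eq_right, fuv, fvv, fuu]) <;>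
    (try simp only [fuv, fvv, fuu]) <;> (try split_ifs) <;> omega

set_option maxHeartbeats 4000000 in
theorem F0_inj (q s s' : ℤ) (T e T' e' : ℕ) (hq : 3 ≤ q) (hT : T < 3) (he : e < 2) (h0 : 0 ≤ s)
    (hi : 2 * s + e < 4 * q + 2) (hT' : T' < 3) (he' : e' < 2) (h0' : 0 ≤ s')
    (hi' : 2 * s' + e' < 4 * q + 2) (hk : 2 * T + e ≤ 2 * T' + e')
    (h : F0 q s T e = F0 q s' T' e') : T = T' ∧ e = e' ∧ s = s' := by
  interval_cases T <;> interval_cases e <;> interval_cases T' <;> interval_cases e' <;>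
    (try exact absurd hk (by decide)) <;> clear hk hT he hT' he' <;>
    simp only [F0] at h <;> split_ifs at h <;>
    simp only [Prod.mk.injEq] at h <;> obtain ⟨h1, h2, h3⟩ := h <;>
    first
    | (exfalso; omega)
    | exact ⟨rfl, rfl, by omega⟩

set_option maxHeartbeats 4000000 in
theorem F1_spec (q T e s : ℕ) (hq : 3 ≤ q) (hT : T < 3) (he : e < 2)
    (hi : 2 * s + e < 4 * q + 3) :
    (((eV (4 * q + 3) T (2 * s + e) : ℕ) : ℤ),
      ((eV (4 * q + 3) T (rel (4 * q + 3) 1 (2 * s + e)) : ℕ) : ℤ),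
      ((eU (4 * q + 3) T (rel (4 * q + 3) (2 * q) (2 * s + e)) : ℕ) : ℤ)) =
        F1 q s T e := by
  interval_cases T <;> interval_cases e <;> simp only [F1] <;> split_ifs <;>
    simp only [Prod.mk.injEq, eV, eU, rel] <;> refine ⟨?_, ?_, ?_⟩ <;>
    (try simp (disch := omega) only [if_pos, if_neg, min_eq_left, min_eq_right, fuv, fvv, fuu]) <;>
    (try simp only [fuv, fvv, fuu]) <;> (try split_ifs) <;> omega

set_option maxHeartbeats 4000000 in
theorem F1_inj (q s s' : ℤ) (T e T' e' : ℕ) (hq : 3 ≤ q) (hT : T < 3) (he : e < 2) (h0 : 0 ≤ s)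
    (hi : 2 * s + e < 4 * q + 3) (hT' : T' < 3) (he' : e' < 2) (h0' : 0 ≤ s')
    (hi' : 2 * s' + e' < 4 * q + 3) (hk : 2 * T + e ≤ 2 * T' + e')
    (h : F1 q s T e = F1 q s' T' e') : T = T' ∧ e = e' ∧ s = s' := by
  interval_cases T <;> interval_cases e <;> interval_cases T' <;> interval_cases e' <;>
    (try exact absurd hk (by decide)) <;> clear hk hT he hT' he' <;>
    simp only [F1] at h <;> split_ifs at h <;>
    simp only [Prod.mk.injEq] at h <;> obtain ⟨h1, h2, h3⟩ := h <;>
    first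
    | (exfalso; omega)
    | exact ⟨rfl, rfl, by omega⟩

set_option maxHeartbeats 4000000 in
theorem F2_spec (q T e s : ℕ) (hq : 3 ≤ q) (hT : T < 3) (he : e < 2)
    (hi : 2 * s + e < 4 * q + 4) :
    (((eV (4 * q + 4) T (2 * s + e) : ℕ) : ℤ),
      ((eV (4 * q + 4) T (rel (4 * q + 4) 1 (2 * s + e)) : ℕ) : ℤ),
      ((eU (4 * q + 4) T (rel (4 * q + 4) (2 * q) (2 * s + e)) : ℕ) : ℤ)) =
        F2 q s T e := by
  interval_cases T <;> interval_cases e <;> simp only [F2] <;> split_ifs <;>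
    simp only [Prod.mk.injEq, eV, eU, rel] <;> refine ⟨?_, ?_, ?_⟩ <;>
    (try simp (disch := omega) only [if_pos, if_neg, min_eq_left, min_eq_right, fuv, fvv, fuu]) <;>
    (try simp only [fuv, fvv, fuu]) <;> (try split_ifs) <;> omega

set_option maxHeartbeats 4000000 in
theorem F2_inj (q s s' : ℤ) (T e T' e' : ℕ) (hq : 3 ≤ q) (hT : T < 3) (he : e < 2) (h0 : 0 ≤ s)
    (hi : 2 * s + e < 4 * q + 4) (hT' : T' < 3) (he' : e' < 2) (h0' : 0 ≤ s')
    (hi' : 2 * s' + e' < 4 * q + 4) (hk : 2 * T + e ≤ 2 * T' + e')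
    (h : F2 q s T e = F2 q s' T' e') : T = T' ∧ e = e' ∧ s = s' := by
  interval_cases T <;> interval_cases e <;> interval_cases T' <;> interval_cases e' <;>
    (try exact absurd hk (by decide)) <;> clear hk hT he hT' he' <;>
    simp only [F2] at h <;> split_ifs at h <;>
    simp only [Prod.mk.injEq] at h <;> obtain ⟨h1, h2, h3⟩ := h <;>
    first
    | (exfalso; omega)
    | exact ⟨rfl, rfl, by omega⟩

set_option maxHeartbeats 4000000 in
theorem F3_spec (q T e s : ℕ) (hq : 3 ≤ q) (hT : T < 3) (he : e < 2)
    (hi : 2 * s + e < 4 * q + 5) :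
    (((eV (4 * q + 5) T (2 * s + e) : ℕ) : ℤ),
      ((eV (4 * q + 5) T (rel (4 * q + 5) 1 (2 * s + e)) : ℕ) : ℤ),
      ((eU (4 * q + 5) T (rel (4 * q + 5) (2 * q) (2 * s + e)) : ℕ) : ℤ)) =
        F3 q s T e := by
  interval_cases T <;> interval_cases e <;> simp only [F3] <;> split_ifs <;>
    simp only [Prod.mk.injEq, eV, eU, rel] <;> refine ⟨?_, ?_, ?_⟩ <;>
    (try simp (disch := omega) only [if_pos, if_neg, min_eq_left, min_eq_right, fuv, fvv, fuu]) <;>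
    (try simp only [fuv, fvv, fuu]) <;> (try split_ifs) <;> omega

set_option maxHeartbeats 4000000 in
theorem F3_inj (q s s' : ℤ) (T e T' e' : ℕ) (hq : 3 ≤ q) (hT : T < 3) (he : e < 2) (h0 : 0 ≤ s)
    (hi : 2 * s + e < 4 * q + 5) (hT' : T' < 3) (he' : e' < 2) (h0' : 0 ≤ s')
    (hi' : 2 * s' + e' < 4 * q + 5) (hk : 2 * T + e ≤ 2 * T' + e')
    (h : F3 q s T e = F3 q s' T' e') : T = T' ∧ e = e' ∧ s = s' := by
  interval_cases T <;> interval_cases e <;> interval_cases T' <;> interval_cases e' <;>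
    (try exact absurd hk (by decide)) <;> clear hk hT he hT' he' <;>
    simp only [F3] at h <;> split_ifs at h <;>
    simp only [Prod.mk.injEq] at h <;> obtain ⟨h1, h2, h3⟩ := h <;>
    first
    | (exfalso; omega)
    | exact ⟨rfl, rfl, by omega⟩


theorem dist_eq_of {V : Type*} (G : SimpleGraph V) (w : V) (F : V → ℕ) (hw : F w = 0)
    (h0 : ∀ x, F x = 0 → x = w) (hL : ∀ x y, G.Adj x y → F x ≤ F y + 1)
    (hd : ∀ x, F x ≠ 0 → ∃ y, G.Adj x y ∧ F y + 1 ≤ F x) (x : V) : G.dist w x = F x := by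
  have h1 : ∀ k x, F x ≤ k → ∃ p : G.Walk w x, p.length ≤ k := by
    intro k
    induction k with
    | zero =>
      intro x hx
      have := h0 x (by omega)
      subst this
      exact ⟨SimpleGraph.Walk.nil, by simp⟩
    | succ k ih =>
      intro x hx
      by_cases hx0 : F x = 0
      · obtain ⟨p, hp⟩ := ih x (by omega)
        exact ⟨p, by omega⟩
      · obtain ⟨y, hy, hy'⟩ := hd x hx0
        obtain ⟨p, hp⟩ := ih y (by omega)
        exact ⟨p.concat hy.symm, by simp; omega⟩
  have h2 : ∀ x y (p : G.Walk x y), F y ≤ F x + p.length := by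
    intro x y p
    induction p with
    | nil => simp
    | cons h p ih =>
      have := hL _ _ h.symm
      simp only [SimpleGraph.Walk.length_cons]
      omega
  obtain ⟨p, hp⟩ := h1 (F x) x le_rfl
  apply le_antisymm
  · exact (SimpleGraph.dist_le p).trans hp
  · obtain ⟨p', hp'⟩ := SimpleGraph.Reachable.exists_walk_length_eq_dist ⟨p⟩
    have := h2 _ _ p'
    omega

def nf {n : ℕ} (i : Fin n) (k : ℕ) : Fin n := ⟨(i + k) % n, Nat.mod_lt _ i.pos⟩
def pf {n : ℕ} (i : Fin n) (k : ℕ) : Fin n := ⟨(i + (n - k)) % n, Nat.mod_lt _ i.pos⟩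

theorem nf_val {n : ℕ} (i : Fin n) (k : ℕ) (hk : k < n) : (nf i k : ℕ) = nx n i k := by
  have := i.isLt
  unfold nf nx
  split_ifs with h
  · exact Nat.mod_eq_of_lt h
  · simp only
    rw [Nat.mod_eq_sub_mod (by omega), Nat.mod_eq_of_lt (by omega)]

def px (n i k : ℕ) : ℕ := if k ≤ i then i - k else i + n - k

theorem pf_val {n : ℕ} (i : Fin n) (k : ℕ) (hk : k < n) : (pf i k : ℕ) = px n i k := by
  have := i.isLt
  unfold pf px
  split_ifs with h
  · simp only
    rw [Nat.mod_eq_sub_mod (by omega), Nat.mod_eq_of_lt (by omega)]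
    omega
  · simp only
    rw [Nat.mod_eq_of_lt (by omega)]
    omega

theorem nf_pf {n : ℕ} (i : Fin n) (k : ℕ) (hk : k < n) : nf (pf i k) k = i := by
  have := i.isLt
  apply Fin.ext
  rw [nf_val _ _ hk, pf_val _ _ hk]
  unfold nx px; split_ifs <;> omega

theorem rel_px (n a i k : ℕ) (hk : k < n) (ha : a < n) (hi : i < n) :
    rel n a (px n i k) = px n (rel n a i) k := by
  unfold rel px; split_ifs <;> omega

theorem adj_u {n : ℕ} (hn : 8 ≤ n) (i : Fin n) : (GP n 2).Adj (Sum.inl i) (Sum.inl (nf i 1)) := by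
  have := i.isLt
  refine ⟨?_, Or.inl rfl⟩
  intro h
  have h := congrArg Fin.val (Sum.inl.inj h)
  rw [nf_val _ _ (by omega)] at h
  unfold nx at h; split_ifs at h <;> omega

theorem adj_v {n : ℕ} (hn : 8 ≤ n) (i : Fin n) : (GP n 2).Adj (Sum.inr i) (Sum.inr (nf i 2)) := by
  have := i.isLt
  refine ⟨?_, Or.inl rfl⟩
  intro h
  have h := congrArg Fin.val (Sum.inr.inj h)
  rw [nf_val _ _ (by omega)] at h
  unfold nx at h; split_ifs at h <;> omega

theorem adj_s {n : ℕ} (i : Fin n) : (GP n 2).Adj (Sum.inl i) (Sum.inr i) := by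
  refine ⟨by simp, Or.inl rfl⟩

theorem adj_u' {n : ℕ} (hn : 8 ≤ n) (i : Fin n) : (GP n 2).Adj (Sum.inl i) (Sum.inl (pf i 1)) := by
  have := adj_u hn (pf i 1)
  rw [nf_pf _ _ (by omega)] at this
  exact this.symm

theorem adj_v' {n : ℕ} (hn : 8 ≤ n) (i : Fin n) : (GP n 2).Adj (Sum.inr i) (Sum.inr (pf i 2)) := by
  have := adj_v hn (pf i 2)
  rw [nf_pf _ _ (by omega)] at this
  exact this.symm

/-- every adjacent pair is one of the three kinds -/
theorem adj_cases {n : ℕ} (P : Fin n ⊕ Fin n → Fin n ⊕ Fin n → Prop) (hs : ∀ x y, P x y → P y x)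
    (hu : ∀ i, P (Sum.inl i) (Sum.inl (nf i 1))) (hv : ∀ i, P (Sum.inr i) (Sum.inr (nf i 2)))
    (hm : ∀ i, P (Sum.inl i) (Sum.inr i)) (x y) (h : (GP n 2).Adj x y) : P x y := by
  obtain ⟨_, h⟩ := h
  rcases x with i | i <;> rcases y with j | j <;> simp only at h
  · rcases h with h | h
    · have : j = nf i 1 := Fin.ext h
      subst this; exact hu _
    · have : i = nf j 1 := Fin.ext h
      subst this; exact hs _ _ (hu _)
  · rcases h with h | h
    · subst h; exact hm _
    · exact h.elim
  · rcases h with h | h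
    · exact h.elim
    · subst h; exact hs _ _ (hm _)
  · rcases h with h | h
    · have : j = nf i 2 := Fin.ext h
      subst this; exact hv _
    · have : i = nf j 2 := Fin.ext h
      subst this; exact hs _ _ (hv _)

def mf (f : ℕ → ℕ) (n j : ℕ) : ℕ := min (f j) (f (n - j))

theorem mf_rev {f : ℕ → ℕ} {n j : ℕ} : mf f n j ≤ f j := min_le_left _ _
theorem mf_rev' {f : ℕ → ℕ} {n j : ℕ} : mf f n j ≤ f (n - j) := min_le_right _ _

theorem lip_uv1 (n j : ℕ) (hn : 8 ≤ n) (hj : j < n) : mf fuv n j ≤ mf fuv n (nx n j 1) + 1 ∧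
    mf fuv n (nx n j 1) ≤ mf fuv n j + 1 := by
  unfold nx mf fuv; split_ifs <;> omega
theorem lip_uu1 (n j : ℕ) (hn : 8 ≤ n) (hj : j < n) : mf fuu n j ≤ mf fuu n (nx n j 1) + 1 ∧
    mf fuu n (nx n j 1) ≤ mf fuu n j + 1 := by
  unfold nx mf fuu; split_ifs <;> omega
theorem lip_uv2 (n j : ℕ) (hn : 8 ≤ n) (hj : j < n) : mf fuv n j ≤ mf fuv n (nx n j 2) + 1 ∧
    mf fuv n (nx n j 2) ≤ mf fuv n j + 1 := by
  unfold nx mf fuv; split_ifs <;> omega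
theorem lip_vv2 (n j : ℕ) (hn : 8 ≤ n) (hj : j < n) : mf fvv n j ≤ mf fvv n (nx n j 2) + 1 ∧
    mf fvv n (nx n j 2) ≤ mf fvv n j + 1 := by
  have key : ∀ x, fvv (x + 2) = fvv x + 1 := by intro x; unfold fvv; omega
  have f0 : fvv 0 = 0 := rfl
  have f1 : fvv 1 = 3 := rfl
  have f2 : fvv 2 = 1 := rfl
  unfold nx mf; split_ifs with h
  · obtain ⟨k, rfl⟩ : ∃ k, n = k + (j + 2) := ⟨n - (j + 2), by omega⟩
    rw [show k + (j + 2) - (j + 2) = k by omega, show k + (j + 2) - j = k + 2 by omega,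
      key, key]
    omega
  · rcases (by omega : j + 2 = n ∨ j + 1 = n) with rfl | rfl
    · rw [show j + 2 - (j + 2) = 0 by omega, show j + 2 - j = 2 by omega, f0, f2]
      omega
    · rw [show j + 2 - (j + 1) = 1 by omega, show j + 1 - j = 1 by omega,
        show j + 1 - 1 = j by omega, f1]
      omega
theorem lip_uvvv (n j : ℕ) : mf fuv n j ≤ mf fvv n j + 1 ∧ mf fvv n j ≤ mf fuv n j + 1 := by
  unfold mf fuv fvv; omega
theorem lip_uuuv (n j : ℕ) : mf fuu n j ≤ mf fuv n j + 1 ∧ mf fuv n j ≤ mf fuu n j + 1 := by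
  unfold mf fuu fuv; omega

theorem mf_cases (f : ℕ → ℕ) (n j : ℕ) : mf f n j = f j ∨ mf f n j = f (n - j) := by
  unfold mf; omega

theorem mf_px (f : ℕ → ℕ) (n j k : ℕ) (h : k ≤ j) : mf f n (px n j k) ≤ f (j - k) := by
  unfold px; rw [if_pos h]; exact mf_rev
theorem mf_nx (f : ℕ → ℕ) (n j k : ℕ) (hj : j < n) (h : k ≤ n - j) :
    mf f n (nx n j k) ≤ f (n - j - k) := by
  unfold nx; split_ifs with h'
  · refine mf_rev'.trans (le_of_eq ?_); congr 1; omega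
  · refine mf_rev.trans (le_of_eq ?_); congr 1; omega

theorem desc (f g : ℕ → ℕ) (k : ℕ)
    (H : ∀ j, f j ≠ 0 → g j + 1 ≤ f j ∨ (k ≤ j ∧ f (j - k) + 1 ≤ f j))
    (n j : ℕ) (hj : j < n) (h : mf f n j ≠ 0) :
    mf g n j + 1 ≤ mf f n j ∨ mf f n (nx n j k) + 1 ≤ mf f n j ∨
      mf f n (px n j k) + 1 ≤ mf f n j := by
  rcases mf_cases f n j with e | e
  · rw [e] at h ⊢
    have a1 := mf_rev (f := g) (n := n) (j := j)
    rcases H j h with h1 | ⟨h1, h2⟩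
    · omega
    · have := mf_px f n j k h1
      omega
  · rw [e] at h ⊢
    have a1 := mf_rev' (f := g) (n := n) (j := j)
    rcases H (n - j) h with h1 | ⟨h1, h2⟩
    · omega
    · have := mf_nx f n j k hj h1
      omega

theorem dist_gen {n : ℕ} (hn : 8 ≤ n) (f g : ℕ → ℕ) (w : Fin n ⊕ Fin n) (a : ℕ) (ha : a < n)
    (hw : Sum.elim (fun i : Fin n => mf f n (rel n a i)) (fun i : Fin n => mf g n (rel n a i)) w = 0)
    (h0 : ∀ x, Sum.elim (fun i : Fin n => mf f n (rel n a i))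
      (fun i : Fin n => mf g n (rel n a i)) x = 0 → x = w)
    (l1 : ∀ j, j < n → mf f n j ≤ mf f n (nx n j 1) + 1 ∧ mf f n (nx n j 1) ≤ mf f n j + 1)
    (l2 : ∀ j, j < n → mf g n j ≤ mf g n (nx n j 2) + 1 ∧ mf g n (nx n j 2) ≤ mf g n j + 1)
    (l3 : ∀ j, mf f n j ≤ mf g n j + 1 ∧ mf g n j ≤ mf f n j + 1)
    (H1 : ∀ j, f j ≠ 0 → g j + 1 ≤ f j ∨ (1 ≤ j ∧ f (j - 1) + 1 ≤ f j))
    (H2 : ∀ j, g j ≠ 0 → f j + 1 ≤ g j ∨ (2 ≤ j ∧ g (j - 2) + 1 ≤ g j)) (x : Fin n ⊕ Fin n) :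
    (GP n 2).dist w x =
      Sum.elim (fun i : Fin n => mf f n (rel n a i)) (fun i : Fin n => mf g n (rel n a i)) x := by
  apply dist_eq_of _ _ _ hw h0
  · intro x y hxy
    refine (adj_cases (fun x y => Sum.elim (fun i : Fin n => mf f n (rel n a i))
      (fun i : Fin n => mf g n (rel n a i)) x ≤ Sum.elim (fun i : Fin n => mf f n (rel n a i))
      (fun i : Fin n => mf g n (rel n a i)) y + 1 ∧ Sum.elim (fun i : Fin n => mf f n (rel n a i))
      (fun i : Fin n => mf g n (rel n a i)) y ≤ Sum.elim (fun i : Fin n => mf f n (rel n a i))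
      (fun i : Fin n => mf g n (rel n a i)) x + 1) (fun x y h => ⟨h.2, h.1⟩) ?_ ?_ ?_ x y hxy).1
    · intro i
      simp only [Sum.elim_inl]
      rw [nf_val _ _ (by omega), rel_nx _ _ _ _ (by omega) ha i.isLt]
      exact l1 _ (rel_lt _ _ _ ha i.isLt)
    · intro i
      simp only [Sum.elim_inr]
      rw [nf_val _ _ (by omega), rel_nx _ _ _ _ (by omega) ha i.isLt]
      exact l2 _ (rel_lt _ _ _ ha i.isLt)
    · intro i
      exact l3 _
  · rintro (i | i) h
    · have hj := rel_lt n a i ha i.isLt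
      rcases desc f g 1 H1 n _ hj h with h | h | h
      · exact ⟨_, adj_s i, h⟩
      · refine ⟨_, adj_u hn i, ?_⟩
        simp only [Sum.elim_inl]
        rwa [nf_val _ _ (by omega), rel_nx _ _ _ _ (by omega) ha i.isLt]
      · refine ⟨_, adj_u' hn i, ?_⟩
        simp only [Sum.elim_inl]
        rwa [pf_val _ _ (by omega), rel_px _ _ _ _ (by omega) ha i.isLt]
    · have hj := rel_lt n a i ha i.isLt
      rcases desc g f 2 H2 n _ hj h with h | h | h
      · exact ⟨_, (adj_s i).symm, h⟩
      · refine ⟨_, adj_v hn i, ?_⟩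
        simp only [Sum.elim_inr]
        rwa [nf_val _ _ (by omega), rel_nx _ _ _ _ (by omega) ha i.isLt]
      · refine ⟨_, adj_v' hn i, ?_⟩
        simp only [Sum.elim_inr]
        rwa [pf_val _ _ (by omega), rel_px _ _ _ _ (by omega) ha i.isLt]

theorem rel_self (n a : ℕ) : rel n a a = 0 := by unfold rel; simp
theorem rel_zero {n : ℕ} {a i : ℕ} (ha : a < n) (hi : i < n) (h : rel n a i = 0) : i = a := by
  unfold rel at h; split_ifs at h <;> omega

theorem dist_v {n : ℕ} (hn : 8 ≤ n) (a : Fin n) (x : Fin n ⊕ Fin n) :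
    (GP n 2).dist (Sum.inr a) x =
      Sum.elim (fun i : Fin n => dvu n a i) (fun i : Fin n => dvv n a i) x := by
  refine dist_gen hn fuv fvv (Sum.inr a) a a.isLt ?_ ?_ (fun j hj => lip_uv1 n j hn hj)
    (fun j hj => lip_vv2 n j hn hj) (fun j => lip_uvvv n j) ?_ ?_ x
  · simp [rel_self, mf, fvv]
  · rintro (i | i) h
    · simp only [Sum.elim_inl, mf, fuv] at h
      omega
    · simp only [Sum.elim_inr, mf, fvv] at h
      have := rel_lt n a i a.isLt i.isLt
      have := rel_zero a.isLt i.isLt (by omega)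
      rw [Fin.ext this]
  · intro j; unfold fuv fvv; omega
  · intro j; unfold fuv fvv; omega

theorem dist_u {n : ℕ} (hn : 8 ≤ n) (a : Fin n) (x : Fin n ⊕ Fin n) :
    (GP n 2).dist (Sum.inl a) x =
      Sum.elim (fun i : Fin n => duu n a i) (fun i : Fin n => dvu n a i) x := by
  refine dist_gen hn fuu fuv (Sum.inl a) a a.isLt ?_ ?_ (fun j hj => lip_uu1 n j hn hj)
    (fun j hj => lip_uv2 n j hn hj) (fun j => lip_uuuv n j) ?_ ?_ x
  · simp [rel_self, mf, fuu]
  · rintro (i | i) h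
    · simp only [Sum.elim_inl, mf, fuu] at h
      have := rel_lt n a i a.isLt i.isLt
      have := rel_zero a.isLt i.isLt (by omega)
      rw [Fin.ext this]
    · simp only [Sum.elim_inr, mf, fuv] at h
      omega
  · intro j; unfold fuu fuv; omega
  · intro j; unfold fuu fuv; omega

/-- The edges of the graph, listed by kind and index. -/
def edg {n : ℕ} (T : ℕ) (i : Fin n) : Sym2 (Fin n ⊕ Fin n) :=
  match T with
  | 0 => s(Sum.inl i, Sum.inl (nf i 1))
  | 1 => s(Sum.inl i, Sum.inr i)
  | _ => s(Sum.inr i, Sum.inr (nf i 2))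

theorem edg_surj {n : ℕ} (e) (he : e ∈ (GP n 2).edgeSet) : ∃ T < 3, ∃ i : Fin n, e = edg T i := by
  induction e using Sym2.ind with
  | _ x y =>
    refine adj_cases (fun x y => ∃ T < 3, ∃ i : Fin n, s(x, y) = edg T i) ?_ ?_ ?_ ?_ x y he
    · intro x y h
      rwa [Sym2.eq_swap]
    · intro i; exact ⟨0, by norm_num, i, rfl⟩
    · intro i; exact ⟨2, by norm_num, i, rfl⟩
    · intro i; exact ⟨1, by norm_num, i, rfl⟩

theorem upper {n : ℕ} (hn : 8 ≤ n) (t : ℕ) (ht : t < n) (hg : good n t) :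
    IsEdgeGenerator (GP n 2)
      {Sum.inr ⟨0, by omega⟩, Sum.inr ⟨1, by omega⟩, Sum.inl ⟨t, ht⟩} := by
  have key : ∀ T < 3, ∀ i : Fin n, code n t T i =
      (edgeDist (GP n 2) (Sum.inr ⟨0, by omega⟩) (edg T i),
        edgeDist (GP n 2) (Sum.inr ⟨1, by omega⟩) (edg T i),
        edgeDist (GP n 2) (Sum.inl ⟨t, ht⟩) (edg T i)) := by
    intro T hT i
    interval_cases T <;>
      simp only [edg, edgeDist, Sym2.lift_mk, dist_v hn, dist_u hn, Sum.elim_inl, Sum.elim_inr,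
        code, nf_val i 1 (by omega), nf_val i 2 (by omega)]
  intro e₁ h₁ e₂ h₂ h
  obtain ⟨T, hT, i, rfl⟩ := edg_surj e₁ h₁
  obtain ⟨T', hT', j, rfl⟩ := edg_surj e₂ h₂
  have hc : code n t T i = code n t T' j := by
    rw [key T hT, key T' hT', h _ (by simp), h _ (by simp), h _ (by simp)]
  obtain ⟨r1, r2⟩ := hg T hT i i.isLt T' hT' j j.isLt hc
  rw [r1, Fin.ext r2]

theorem lower {n : ℕ} (hn : 8 ≤ n) (S : Set (Fin n ⊕ Fin n)) (a b : Fin n ⊕ Fin n)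
    (hS : S ⊆ {a, b}) : ¬ IsEdgeGenerator (GP n 2) S := by
  intro hg
  have hc : (GP n 2).Reachable b a := by
    by_contra h
    have e := SimpleGraph.dist_eq_zero_of_not_reachable h
    rcases b with b | b
    · rw [dist_u hn] at e
      rcases a with a | a
      · simp only [Sum.elim_inl, duu, fuu] at e
        have := rel_lt n b a b.isLt a.isLt
        have := rel_zero b.isLt a.isLt (by omega)
        rw [Fin.ext this] at h
        exact h (SimpleGraph.Reachable.refl _)
      · simp only [Sum.elim_inr, dvu, fuv] at e
        omega
    · rw [dist_v hn] at e
      rcases a with a | a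
      · simp only [Sum.elim_inl, dvu, fuv] at e
        omega
      · simp only [Sum.elim_inr, dvv, fvv] at e
        have := rel_lt n b a b.isLt a.isLt
        have := rel_zero b.isLt a.isLt (by omega)
        rw [Fin.ext this] at h
        exact h (SimpleGraph.Reachable.refl _)
  have nbr : ∃ x y z, (GP n 2).Adj a x ∧ (GP n 2).Adj a y ∧ (GP n 2).Adj a z ∧
      x ≠ y ∧ x ≠ z ∧ y ≠ z := by
    have hne : ∀ (i : Fin n) (k : ℕ), 0 < k → k < 3 → nf i k ≠ pf i k := by
      intro i k h1 h2 h
      have h := congrArg Fin.val h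
      have := i.isLt
      rw [nf_val _ _ (by omega), pf_val _ _ (by omega)] at h
      unfold nx px at h
      split_ifs at h <;> omega
    rcases a with i | i
    · exact ⟨_, _, _, adj_u hn i, adj_u' hn i, adj_s i,
        fun h => hne i 1 (by omega) (by omega) (Sum.inl.inj h), by simp, by simp⟩
    · exact ⟨_, _, _, adj_v hn i, adj_v' hn i, (adj_s i).symm,
        fun h => hne i 2 (by omega) (by omega) (Sum.inr.inj h), by simp, by simp⟩
  obtain ⟨x, y, z, hx, hy, hz, hxy, hxz, hyz⟩ := nbr
  have two : ∀ x, (GP n 2).Adj a x → edgeDist (GP n 2) b s(a, x) = (GP n 2).dist b a ∨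
      edgeDist (GP n 2) b s(a, x) + 1 = (GP n 2).dist b a := by
    intro x hx
    have h1 : (GP n 2).dist b a ≤ (GP n 2).dist b x + 1 := by
      have hr : (GP n 2).Reachable b x := hc.trans hx.reachable
      obtain ⟨p, hp⟩ := hr.exists_walk_length_eq_dist
      have := SimpleGraph.dist_le (p.concat hx.symm)
      simp at this
      omega
    simp only [edgeDist, Sym2.lift_mk]
    omega
  have clash : ∀ x y, (GP n 2).Adj a x → (GP n 2).Adj a y → x ≠ y →
      edgeDist (GP n 2) b s(a, x) ≠ edgeDist (GP n 2) b s(a, y) := by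
    intro x y hx hy hxy h
    have := hg s(a, x) hx s(a, y) hy (by
      intro w hw
      rcases hS hw with rfl | rfl
      · simp [edgeDist]
      · exact h)
    exact hxy (Sym2.congr_right.mp this)
  have := clash x y hx hy hxy
  have := clash x z hx hz hxz
  have := clash y z hy hz hyz
  have := two x hx
  have := two y hy
  have := two z hz
  omega

theorem main {n : ℕ} (hn : 8 ≤ n) (t : ℕ) (ht : t < n) (hg : good n t) :
    edgeMetricDim (GP n 2) = 3 := by
  have hmem : 3 ∈ {m | ∃ S : Set (Fin n ⊕ Fin n), S.Finite ∧ S.ncard = m ∧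
      IsEdgeGenerator (GP n 2) S} := by
    refine ⟨_, Set.toFinite _, ?_, upper hn t ht hg⟩
    rw [Set.ncard_eq_three]
    exact ⟨_, _, _, by simp, by simp, by simp, rfl⟩
  apply le_antisymm (Nat.sInf_le hmem)
  obtain ⟨S, hf, hc, hS⟩ := Nat.sInf_mem ⟨3, hmem⟩
  by_contra hlt
  have hlt : S.ncard ≤ 2 := by
    rw [hc]; unfold edgeMetricDim at hlt; omega
  have hsub : ∃ a b, S ⊆ {a, b} := by
    have d : Fin n ⊕ Fin n := Sum.inl ⟨0, by omega⟩
    have h3 : S.ncard = 0 ∨ S.ncard = 1 ∨ S.ncard = 2 := by omega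
    rcases h3 with h3 | h3 | h3
    · rw [Set.ncard_eq_zero hf] at h3
      exact ⟨d, d, by simp [h3]⟩
    · obtain ⟨a, rfl⟩ := Set.ncard_eq_one.mp h3
      exact ⟨a, a, by simp⟩
    · obtain ⟨a, b, _, rfl⟩ := Set.ncard_eq_two.mp h3
      exact ⟨a, b, le_rfl⟩
  obtain ⟨a, b, hab⟩ := hsub
  exact lower hn S a b hab hS

theorem good_0 (q : ℕ) (hq : 3 ≤ q) : good (4 * q + 2) (2 * q) := by
  intro T hT i hi T' hT' j hj h
  rw [code_eq _ _ T i hT (by omega) (by omega) hi,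
    code_eq _ _ T' j hT' (by omega) (by omega) hj] at h
  have ei : i = 2 * (i / 2) + i % 2 := by omega
  have ej : j = 2 * (j / 2) + j % 2 := by omega
  have li : i % 2 < 2 := by omega
  have lj : j % 2 < 2 := by omega
  generalize i / 2 = s at ei
  generalize i % 2 = e at ei li
  generalize j / 2 = s' at ej
  generalize j % 2 = e' at ej lj
  subst ei ej
  have a := F0_spec q T e s hq hT li hi
  have b := F0_spec q T' e' s' hq hT' lj hj
  simp only [Prod.mk.injEq] at h
  rw [h.1, h.2.1, h.2.2] at a
  have c := a.symm.trans b
  rcases le_total (2 * T + e) (2 * T' + e') with hk | hk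
  · have := F0_inj q s s' T e T' e' (by omega) hT li (by omega) (by omega) hT' lj (by omega)
      (by omega) hk c
    omega
  · have := F0_inj q s' s T' e' T e (by omega) hT' lj (by omega) (by omega) hT li (by omega)
      (by omega) hk c.symm
    omega

theorem good_1 (q : ℕ) (hq : 3 ≤ q) : good (4 * q + 3) (2 * q) := by
  intro T hT i hi T' hT' j hj h
  rw [code_eq _ _ T i hT (by omega) (by omega) hi,
    code_eq _ _ T' j hT' (by omega) (by omega) hj] at h
  have ei : i = 2 * (i / 2) + i % 2 := by omega
  have ej : j = 2 * (j / 2) + j % 2 := by omega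
  have li : i % 2 < 2 := by omega
  have lj : j % 2 < 2 := by omega
  generalize i / 2 = s at ei
  generalize i % 2 = e at ei li
  generalize j / 2 = s' at ej
  generalize j % 2 = e' at ej lj
  subst ei ej
  have a := F1_spec q T e s hq hT li hi
  have b := F1_spec q T' e' s' hq hT' lj hj
  simp only [Prod.mk.injEq] at h
  rw [h.1, h.2.1, h.2.2] at a
  have c := a.symm.trans b
  rcases le_total (2 * T + e) (2 * T' + e') with hk | hk
  · have := F1_inj q s s' T e T' e' (by omega) hT li (by omega) (by omega) hT' lj (by omega)
      (by omega) hk c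
    omega
  · have := F1_inj q s' s T' e' T e (by omega) hT' lj (by omega) (by omega) hT li (by omega)
      (by omega) hk c.symm
    omega

theorem good_2 (q : ℕ) (hq : 3 ≤ q) : good (4 * q + 4) (2 * q) := by
  intro T hT i hi T' hT' j hj h
  rw [code_eq _ _ T i hT (by omega) (by omega) hi,
    code_eq _ _ T' j hT' (by omega) (by omega) hj] at h
  have ei : i = 2 * (i / 2) + i % 2 := by omega
  have ej : j = 2 * (j / 2) + j % 2 := by omega
  have li : i % 2 < 2 := by omega
  have lj : j % 2 < 2 := by omega
  generalize i / 2 = s at ei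
  generalize i % 2 = e at ei li
  generalize j / 2 = s' at ej
  generalize j % 2 = e' at ej lj
  subst ei ej
  have a := F2_spec q T e s hq hT li hi
  have b := F2_spec q T' e' s' hq hT' lj hj
  simp only [Prod.mk.injEq] at h
  rw [h.1, h.2.1, h.2.2] at a
  have c := a.symm.trans b
  rcases le_total (2 * T + e) (2 * T' + e') with hk | hk
  · have := F2_inj q s s' T e T' e' (by omega) hT li (by omega) (by omega) hT' lj (by omega)
      (by omega) hk c
    omega
  · have := F2_inj q s' s T' e' T e (by omega) hT' lj (by omega) (by omega) hT li (by omega)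
      (by omega) hk c.symm
    omega

theorem good_3 (q : ℕ) (hq : 3 ≤ q) : good (4 * q + 5) (2 * q) := by
  intro T hT i hi T' hT' j hj h
  rw [code_eq _ _ T i hT (by omega) (by omega) hi,
    code_eq _ _ T' j hT' (by omega) (by omega) hj] at h
  have ei : i = 2 * (i / 2) + i % 2 := by omega
  have ej : j = 2 * (j / 2) + j % 2 := by omega
  have li : i % 2 < 2 := by omega
  have lj : j % 2 < 2 := by omega
  generalize i / 2 = s at ei
  generalize i % 2 = e at ei li
  generalize j / 2 = s' at ej
  generalize j % 2 = e' at ej lj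
  subst ei ej
  have a := F3_spec q T e s hq hT li hi
  have b := F3_spec q T' e' s' hq hT' lj hj
  simp only [Prod.mk.injEq] at h
  rw [h.1, h.2.1, h.2.2] at a
  have c := a.symm.trans b
  rcases le_total (2 * T + e) (2 * T' + e') with hk | hk
  · have := F3_inj q s s' T e T' e' (by omega) hT li (by omega) (by omega) hT' lj (by omega)
      (by omega) hk c
    omega
  · have := F3_inj q s' s T' e' T e (by omega) hT' lj (by omega) (by omega) hT li (by omega)
      (by omega) hk c.symm
    omega

set_option maxRecDepth 10000 in
theorem good_8 : good 8 3 := by decide +kernel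
set_option maxRecDepth 10000 in
theorem good_small : ∀ n < 14, 10 ≤ n → good n (tt n) := by decide +kernel

/-- For `n = 8` and all `n ≥ 10`, `β_E(GP(n,2)) = 3`. -/
theorem stmt10 (n : ℕ) (hn : n = 8 ∨ 10 ≤ n) :
    edgeMetricDim (GP n 2) = 3 := by
  rcases hn with rfl | hn
  · exact main (by omega) 3 (by omega) good_8
  · by_cases h : n < 14
    · exact main (by omega) (tt n) (by unfold tt; split_ifs <;> omega) (good_small n h hn)
    · obtain ⟨q, hq, h4⟩ : ∃ q, 3 ≤ q ∧ (n = 4 * q + 2 ∨ n = 4 * q + 3 ∨ n = 4 * q + 4 ∨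
          n = 4 * q + 5) := ⟨(n - 2) / 4, by omega, by omega⟩
      rcases h4 with rfl | rfl | rfl | rfl
      · exact main (by omega) (2 * q) (by omega) (good_0 q hq)
      · exact main (by omega) (2 * q) (by omega) (good_1 q hq)
      · exact main (by omega) (2 * q) (by omega) (good_2 q hq)
      · exact main (by omega) (2 * q) (by omega) (good_3 q hq)
end

section
/- For n = 4t with t ≥ 4, the set {u_0, v_3, v_{2t+3}} is an edge metric generator of GP(n,2) of size 3, hence β_E(GP(4t,2)) = 3. -/
open SimpleGraph

theorem dist_char {V : Type*} (G : SimpleGraph V) (w : V) (f : V → ℕ) (hw : f w = 0)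
    (h0 : ∀ x, f x = 0 → x = w) (h1 : ∀ x y, G.Adj x y → f y ≤ f x + 1)
    (h2 : ∀ x, f x ≠ 0 → ∃ y, G.Adj y x ∧ f y + 1 = f x) (x : V) :
    G.Reachable w x ∧ G.dist w x = f x := by
  have hlow : ∀ a b (p : G.Walk a b), f b ≤ f a + p.length := by
    intro a b p
    induction p with
    | nil => simp
    | cons h p ih => have := h1 _ _ h; simp; omega
  have hup : ∀ k x, f x = k → ∃ p : G.Walk w x, p.length = k := by
    intro k
    induction k with
    | zero => intro x hx; obtain rfl := h0 x hx; exact ⟨.nil, rfl⟩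
    | succ k ih =>
      intro x hx
      obtain ⟨y, hy, hf⟩ := h2 x (by omega)
      obtain ⟨p, hp⟩ := ih y (by omega)
      exact ⟨p.concat hy, by simp [hp]⟩
  obtain ⟨p, hp⟩ := hup _ x rfl
  refine ⟨⟨p⟩, le_antisymm (hp ▸ dist_le p) ?_⟩
  obtain ⟨q, hq⟩ := Reachable.exists_walk_length_eq_dist (G := G) (u := w) (v := x) ⟨p⟩
  have := hlow _ _ q
  omega

/-- circular distance in the cycle of length `4 * t` -/
def cd (t c i : ℕ) : ℕ := min ((i - c) + (c - i)) (4 * t - ((i - c) + (c - i)))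

theorem mod_ite (n i k : ℕ) (hi : i < n) (hk : k ≤ n) :
    (i + k) % n = if i + k < n then i + k else i + k - n := by
  split_ifs with h
  · exact Nat.mod_eq_of_lt h
  · rw [Nat.mod_eq_sub_mod (by omega), Nat.mod_eq_of_lt (by omega)]

def fUU (m : ℕ) : ℕ := min m ((m + 1) / 2 + 2)
def fUV (m : ℕ) : ℕ := (m + 1) / 2 + 1
def fVV (m : ℕ) : ℕ := if m % 2 = 0 then m / 2 else (m + 1) / 2 + 2

theorem adj_cases_s11 (t : ℕ) (ht : 4 ≤ t) (P : (Fin (4 * t) ⊕ Fin (4 * t)) → (Fin (4 * t) ⊕ Fin (4 * t)) → Prop)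
    (hs : ∀ x y, P x y → P y x)
    (h1 : ∀ i (hi : i < 4 * t) (hi' : (i + 1) % (4 * t) < 4 * t), P (.inl ⟨i, hi⟩) (.inl ⟨(i + 1) % (4 * t), hi'⟩))
    (h2 : ∀ i (hi : i < 4 * t), P (.inl ⟨i, hi⟩) (.inr ⟨i, hi⟩))
    (h3 : ∀ i (hi : i < 4 * t) (hi' : (i + 2) % (4 * t) < 4 * t), P (.inr ⟨i, hi⟩) (.inr ⟨(i + 2) % (4 * t), hi'⟩))
    (x y) (h : (GP (4 * t) 2).Adj x y) : P x y := by
  simp only [GP, fromRel_adj] at h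
  obtain ⟨_, h | h⟩ := h
  · rcases x with ⟨i, hi⟩ | ⟨i, hi⟩ <;> rcases y with ⟨j, hj⟩ | ⟨j, hj⟩ <;> simp at h
    · subst h; exact h1 _ _ _
    · subst h; exact h2 _ _
    · subst h; exact h3 _ _ _
  · apply hs
    rcases x with ⟨i, hi⟩ | ⟨i, hi⟩ <;> rcases y with ⟨j, hj⟩ | ⟨j, hj⟩ <;> simp at h
    · subst h; exact h1 _ _ _
    · subst h; exact h2 _ _
    · subst h; exact h3 _ _ _

theorem adj1 (t : ℕ) (ht : 4 ≤ t) (i j : ℕ) (hi : i < 4 * t) (hj : j < 4 * t)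
    (h : j = i + 1 ∨ j + 4 * t = i + 1) : (GP (4 * t) 2).Adj (.inl ⟨i, hi⟩) (.inl ⟨j, hj⟩) := by
  simp only [GP, fromRel_adj]
  refine ⟨by simp; omega, Or.inl ?_⟩
  simp only [mod_ite (4 * t) i 1 hi (by omega)]
  split_ifs <;> omega

theorem adj2 (t : ℕ) (i : ℕ) (hi : i < 4 * t) :
    (GP (4 * t) 2).Adj (.inl ⟨i, hi⟩) (.inr ⟨i, hi⟩) := by
  simp [GP, fromRel_adj]

theorem adj3 (t : ℕ) (ht : 4 ≤ t) (i j : ℕ) (hi : i < 4 * t) (hj : j < 4 * t)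
    (h : j = i + 2 ∨ j + 4 * t = i + 2) : (GP (4 * t) 2).Adj (.inr ⟨i, hi⟩) (.inr ⟨j, hj⟩) := by
  simp only [GP, fromRel_adj]
  refine ⟨by simp; omega, Or.inl ?_⟩
  simp only [mod_ite (4 * t) i 2 hi (by omega)]
  split_ifs <;> omega

theorem cd_step1 (t c i : ℕ) (hc : c < 4 * t) (hi : i < 4 * t) (ht : 4 ≤ t) :
    let m := cd t c i
    let m' := cd t c ((i + 1) % (4 * t))
    m' = m + 1 ∨ m = m' + 1 := by
  simp only [mod_ite (4 * t) i 1 hi (by omega), cd]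
  split_ifs <;> omega

theorem cd_step2 (t c i : ℕ) (hc : c < 4 * t) (hi : i < 4 * t) (ht : 4 ≤ t) :
    let m := cd t c i
    let m' := cd t c ((i + 2) % (4 * t))
    m' = m + 2 ∨ m = m' + 2 ∨ (m' = m ∧ m % 2 = 1) := by
  simp only [mod_ite (4 * t) i 2 hi (by omega), cd]
  split_ifs <;> omega

theorem cd_zero (t c i : ℕ) (hc : c < 4 * t) (hi : i < 4 * t) (h : cd t c i = 0) : i = c := by
  unfold cd at h; omega

theorem desc1 (t c i : ℕ) (hc : c < 4 * t) (hi : i < 4 * t) (ht : 4 ≤ t) (hm : 1 ≤ cd t c i) :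
    ∃ (j : ℕ) (hj : j < 4 * t), (GP (4 * t) 2).Adj (.inl ⟨j, hj⟩) (.inl ⟨i, hi⟩) ∧
      cd t c j + 1 = cd t c i := by
  have key : ∃ j, j < 4 * t ∧ (i = j + 1 ∨ i + 4 * t = j + 1 ∨ j = i + 1 ∨ j + 4 * t = i + 1) ∧
      cd t c j + 1 = cd t c i := by
    by_cases h : cd t c (if i + 1 < 4 * t then i + 1 else 0) + 1 = cd t c i
    · exact ⟨_, by split_ifs <;> omega, by split_ifs <;> omega, h⟩
    · refine ⟨if i = 0 then 4 * t - 1 else i - 1, by split_ifs <;> omega, by split_ifs <;> omega, ?_⟩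
      unfold cd at *
      split_ifs at * <;> omega
  obtain ⟨j, hj, h, h'⟩ := key
  refine ⟨j, hj, ?_, h'⟩
  rcases h with h | h | h | h
  · exact adj1 t ht _ _ _ _ (.inl h)
  · exact adj1 t ht _ _ _ _ (.inr h)
  · exact (adj1 t ht _ _ _ _ (.inl h)).symm
  · exact (adj1 t ht _ _ _ _ (.inr h)).symm

set_option maxHeartbeats 1000000 in
theorem desc2 (t c i : ℕ) (hc : c < 4 * t) (hi : i < 4 * t) (ht : 4 ≤ t) (hm : 2 ≤ cd t c i) :
    ∃ (j : ℕ) (hj : j < 4 * t), (GP (4 * t) 2).Adj (.inr ⟨j, hj⟩) (.inr ⟨i, hi⟩) ∧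
      cd t c j + 2 = cd t c i := by
  have key : ∃ j, j < 4 * t ∧ (i = j + 2 ∨ i + 4 * t = j + 2 ∨ j = i + 2 ∨ j + 4 * t = i + 2) ∧
      cd t c j + 2 = cd t c i := by
    by_cases h : cd t c (if i + 2 < 4 * t then i + 2 else i + 2 - 4 * t) + 2 = cd t c i
    · exact ⟨_, by split_ifs <;> omega, by split_ifs <;> omega, h⟩
    · refine ⟨if i < 2 then i + 4 * t - 2 else i - 2, by split_ifs <;> omega, by split_ifs <;> omega, ?_⟩
      unfold cd at *
      split_ifs at * <;> omega
  obtain ⟨j, hj, h, h'⟩ := key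
  refine ⟨j, hj, ?_, h'⟩
  rcases h with h | h | h | h
  · exact adj3 t ht _ _ _ _ (.inl h)
  · exact adj3 t ht _ _ _ _ (.inr h)
  · exact (adj3 t ht _ _ _ _ (.inl h)).symm
  · exact (adj3 t ht _ _ _ _ (.inr h)).symm

theorem lip_U (t c : ℕ) (hc : c < 4 * t) (ht : 4 ≤ t) (x y) (h : (GP (4 * t) 2).Adj x y) :
    let f : Fin (4 * t) ⊕ Fin (4 * t) → ℕ :=
      Sum.elim (fun i => fUU (cd t c i)) (fun i => fUV (cd t c i))
    f y ≤ f x + 1 := by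
  intro f
  refine (adj_cases_s11 t ht (fun x y => f y ≤ f x + 1 ∧ f x ≤ f y + 1) ?_ ?_ ?_ ?_ x y h).1
  · exact fun x y h => ⟨h.2, h.1⟩
  · intro i hi hi'
    have := cd_step1 t c i hc hi ht
    simp only [f, Sum.elim_inl, fUU] at *
    omega
  · intro i hi
    simp only [f, Sum.elim_inl, Sum.elim_inr, fUU, fUV] at *
    omega
  · intro i hi hi'
    have := cd_step2 t c i hc hi ht
    simp only [f, Sum.elim_inr, fUV] at *
    omega

theorem lip_V (t c : ℕ) (hc : c < 4 * t) (ht : 4 ≤ t) (x y) (h : (GP (4 * t) 2).Adj x y) :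
    let f : Fin (4 * t) ⊕ Fin (4 * t) → ℕ :=
      Sum.elim (fun i => fUV (cd t c i)) (fun i => fVV (cd t c i))
    f y ≤ f x + 1 := by
  intro f
  refine (adj_cases_s11 t ht (fun x y => f y ≤ f x + 1 ∧ f x ≤ f y + 1) ?_ ?_ ?_ ?_ x y h).1
  · exact fun x y h => ⟨h.2, h.1⟩
  · intro i hi hi'
    have := cd_step1 t c i hc hi ht
    simp only [f, Sum.elim_inl, fUV] at *
    omega
  · intro i hi
    simp only [f, Sum.elim_inl, Sum.elim_inr, fVV, fUV] at *
    split_ifs <;> omega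
  · intro i hi hi'
    have := cd_step2 t c i hc hi ht
    simp only [f, Sum.elim_inr, fVV] at *
    split_ifs <;> omega

theorem cd_self (t c : ℕ) : cd t c c = 0 := by simp [cd]

theorem dist_U (t c : ℕ) (hc : c < 4 * t) (ht : 4 ≤ t) (x) :
    (GP (4 * t) 2).Reachable (.inl ⟨c, hc⟩) x ∧ (GP (4 * t) 2).dist (.inl ⟨c, hc⟩) x =
      Sum.elim (fun i : Fin (4 * t) => fUU (cd t c i)) (fun i : Fin (4 * t) => fUV (cd t c i)) x := by
  apply dist_char
  · simp [cd_self, fUU]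
  · rintro (⟨i, hi⟩ | ⟨i, hi⟩) h
    · simp only [Sum.elim_inl, fUU] at h
      have := cd_zero t c i hc hi (by omega)
      subst this; rfl
    · simp only [Sum.elim_inr, fUV] at h
      omega
  · exact fun x y h => lip_U t c hc ht x y h
  · rintro (⟨i, hi⟩ | ⟨i, hi⟩) h
    · simp only [Sum.elim_inl, fUU] at h
      by_cases hh : (cd t c i + 1) / 2 + 2 ≤ cd t c i
      · exact ⟨_, (adj2 t i hi).symm, by simp only [Sum.elim_inl, Sum.elim_inr, fUU, fUV]; omega⟩
      · obtain ⟨j, hj, ha, he⟩ := desc1 t c i hc hi ht (by omega)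
        exact ⟨_, ha, by simp only [Sum.elim_inl, fUU]; omega⟩
    · by_cases hh : cd t c i < 2
      · exact ⟨_, adj2 t i hi, by simp only [Sum.elim_inl, Sum.elim_inr, fUU, fUV]; omega⟩
      · obtain ⟨j, hj, ha, he⟩ := desc2 t c i hc hi ht (by omega)
        exact ⟨_, ha, by simp only [Sum.elim_inr, fUV]; omega⟩

theorem dist_V (t c : ℕ) (hc : c < 4 * t) (ht : 4 ≤ t) (x) :
    (GP (4 * t) 2).Reachable (.inr ⟨c, hc⟩) x ∧ (GP (4 * t) 2).dist (.inr ⟨c, hc⟩) x =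
      Sum.elim (fun i : Fin (4 * t) => fUV (cd t c i)) (fun i : Fin (4 * t) => fVV (cd t c i)) x := by
  apply dist_char
  · simp [cd_self, fVV]
  · rintro (⟨i, hi⟩ | ⟨i, hi⟩) h
    · simp only [Sum.elim_inl, fUV] at h
      omega
    · simp only [Sum.elim_inr, fVV] at h
      have := cd_zero t c i hc hi (by split_ifs at h <;> omega)
      subst this; rfl
  · exact fun x y h => lip_V t c hc ht x y h
  · rintro (⟨i, hi⟩ | ⟨i, hi⟩) h
    · by_cases hh : cd t c i % 2 = 0
      · exact ⟨_, (adj2 t i hi).symm, by simp only [Sum.elim_inl, Sum.elim_inr, fVV, fUV]; split_ifs; omega⟩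
      · obtain ⟨j, hj, ha, he⟩ := desc1 t c i hc hi ht (by omega)
        exact ⟨_, ha, by simp only [Sum.elim_inl, fUV]; omega⟩
    · simp only [Sum.elim_inr, fVV] at h
      by_cases hh : cd t c i % 2 = 0
      · obtain ⟨j, hj, ha, he⟩ := desc2 t c i hc hi ht (by split_ifs at h; omega)
        exact ⟨_, ha, by simp only [Sum.elim_inr, fVV]; split_ifs <;> omega⟩
      · exact ⟨_, adj2 t i hi, by simp only [Sum.elim_inl, Sum.elim_inr, fVV, fUV]; split_ifs; omega⟩

theorem three_le {V : Type*} (G : SimpleGraph V) (hG : G.Connected)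
    (h3 : ∀ w, ∃ x y z, G.Adj w x ∧ G.Adj w y ∧ G.Adj w z ∧ x ≠ y ∧ x ≠ z ∧ y ≠ z)
    (S : Set V) (hf : S.Finite) (hS : IsEdgeGenerator G S) : 3 ≤ S.ncard := by
  by_contra hlt
  obtain ⟨w, s, hw, hws⟩ : ∃ w s, (S = ∅ ∨ w ∈ S) ∧ S ⊆ {w, s} := by
    have : S.ncard = 0 ∨ S.ncard = 1 ∨ S.ncard = 2 := by omega
    rcases this with h | h | h
    · rw [Set.ncard_eq_zero hf] at h
      obtain ⟨a⟩ := hG.nonempty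
      exact ⟨a, a, .inl h, by simp [h]⟩
    · obtain ⟨a, rfl⟩ := Set.ncard_eq_one.1 h
      exact ⟨a, a, by simp, by simp⟩
    · obtain ⟨a, b, _, rfl⟩ := Set.ncard_eq_two.1 h
      exact ⟨a, b, by simp, by simp⟩
  obtain ⟨x, y, z, hx, hy, hz, hxy, hxz, hyz⟩ := h3 w
  have hb : ∀ a, G.Adj w a → edgeDist G s s(w, a) = G.dist s w ∨
      edgeDist G s s(w, a) + 1 = G.dist s w := by
    intro a ha
    have h1 := hG.dist_triangle (u := s) (v := a) (w := w)
    have h2 : G.dist a w = 1 := dist_eq_one_iff_adj.2 ha.symm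
    simp only [edgeDist, Sym2.lift_mk]
    omega
  have hc : ∀ a b, G.Adj w a → G.Adj w b → edgeDist G s s(w, a) = edgeDist G s s(w, b) → a = b := by
    intro a b ha hb h
    have := hS s(w, a) ha s(w, b) hb ?_
    · have h' := hb.ne
      simp at this
      rcases this with h | ⟨h, _⟩
      · exact h
      · exact absurd h h'
    · intro r hr
      rcases hws hr with rfl | hr
      · simp [edgeDist]
      · rw [Set.mem_singleton_iff] at hr; rw [hr]; exact h
  have hx' := hb x hx
  have hy' := hb y hy
  have hz' := hb z hz
  have a1 := mt (hc x y hx hy) hxy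
  have a2 := mt (hc x z hx hz) hxz
  have a3 := mt (hc y z hy hz) hyz
  omega

theorem cd_anti (t i : ℕ) (hi : i < 4 * t) (ht : 4 ≤ t) :
    cd t (2 * t + 3) i + cd t 3 i = 2 * t := by
  unfold cd; omega

theorem cd3_cases (t i : ℕ) (hi : i < 4 * t) (ht : 4 ≤ t) :
    (i < 3 ∧ cd t 3 i + i = 3) ∨ (3 ≤ i ∧ i ≤ 2 * t + 3 ∧ cd t 3 i + 3 = i) ∨
      (2 * t + 3 < i ∧ cd t 3 i + i = 4 * t + 3) := by
  unfold cd; omega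

theorem cd0_cases (t i : ℕ) (hi : i < 4 * t) :
    (i ≤ 2 * t ∧ cd t 0 i = i) ∨ (2 * t < i ∧ cd t 0 i + i = 4 * t) := by
  unfold cd; omega

theorem mod_cases (n i k : ℕ) (hi : i < n) (hk : k ≤ n) :
    (i + k < n ∧ (i + k) % n = i + k) ∨ (n ≤ i + k ∧ (i + k) % n + n = i + k) := by
  rw [mod_ite n i k hi hk]; split_ifs <;> omega

theorem fVV_cases (m : ℕ) : (m % 2 = 0 ∧ 2 * fVV m = m) ∨ (m % 2 = 1 ∧ 2 * fVV m = m + 5) := by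
  unfold fVV; split_ifs <;> omega

theorem fUV_cases (m : ℕ) : (m % 2 = 0 ∧ 2 * fUV m = m + 2) ∨ (m % 2 = 1 ∧ 2 * fUV m = m + 3) := by
  unfold fUV; omega

/-- distance to outer edges -/
def bUU (t c i : ℕ) : ℕ := min (fUV (cd t c i)) (fUV (cd t c ((i + 1) % (4 * t))))
def bUV (t c i : ℕ) : ℕ := min (fUV (cd t c i)) (fVV (cd t c i))
def bVV (t c i : ℕ) : ℕ := min (fVV (cd t c i)) (fVV (cd t c ((i + 2) % (4 * t))))
def aUU (t i : ℕ) : ℕ := min (fUU (cd t 0 i)) (fUU (cd t 0 ((i + 1) % (4 * t))))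
def aUV (t i : ℕ) : ℕ := min (fUU (cd t 0 i)) (fUV (cd t 0 i))
def aVV (t i : ℕ) : ℕ := min (fUV (cd t 0 i)) (fUV (cd t 0 ((i + 2) % (4 * t))))

theorem sum_UU (t i : ℕ) (hi : i < 4 * t) (ht : 4 ≤ t) :
    bUU t 3 i + bUU t (2 * t + 3) i = t + 2 := by
  have h1 := cd_step1 t 3 i (by omega) hi ht
  have h2 := cd_anti t i hi ht
  have h3 := cd_anti t ((i + 1) % (4 * t)) (Nat.mod_lt _ (by omega)) ht
  unfold bUU fUV
  dsimp only at h1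
  omega

theorem sum_UV (t i : ℕ) (hi : i < 4 * t) (ht : 4 ≤ t) :
    (cd t 3 i % 2 = 0 ∧ bUV t 3 i + bUV t (2 * t + 3) i = t ∧ 2 * bUV t 3 i = cd t 3 i) ∨
    (cd t 3 i % 2 = 1 ∧ bUV t 3 i + bUV t (2 * t + 3) i = t + 3 ∧ 2 * bUV t 3 i = cd t 3 i + 3) := by
  have h2 := cd_anti t i hi ht
  have h3 := fVV_cases (cd t 3 i)
  have h4 := fVV_cases (cd t (2 * t + 3) i)
  unfold bUV fUV
  omega

theorem sum_VV (t i : ℕ) (hi : i < 4 * t) (ht : 4 ≤ t) :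
    (cd t 3 i % 2 = 0 ∧ bVV t 3 i + bVV t (2 * t + 3) i = t - 1 ∧
      2 * bVV t 3 i = min (cd t 3 i) (cd t 3 ((i + 2) % (4 * t)))) ∨
    (cd t 3 i % 2 = 1 ∧ t + 4 ≤ bVV t 3 i + bVV t (2 * t + 3) i ∧
      2 * bVV t 3 i = min (cd t 3 i) (cd t 3 ((i + 2) % (4 * t))) + 5) := by
  have h1 := cd_step2 t 3 i (by omega) hi ht
  have h2 := cd_anti t i hi ht
  have h3 := cd_anti t ((i + 2) % (4 * t)) (Nat.mod_lt _ (by omega)) ht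
  have h4 := fVV_cases (cd t 3 i)
  have h5 := fVV_cases (cd t (2 * t + 3) i)
  have h6 := fVV_cases (cd t 3 ((i + 2) % (4 * t)))
  have h7 := fVV_cases (cd t (2 * t + 3) ((i + 2) % (4 * t)))
  unfold bVV
  dsimp only at h1
  rcases h1 with h1 | h1 | h1 <;> omega

theorem inj_UV (t i j : ℕ) (hi : i < 4 * t) (hj : j < 4 * t) (ht : 4 ≤ t)
    (ha : aUV t i = aUV t j) (hb : bUV t 3 i = bUV t 3 j)
    (hc : bUV t (2 * t + 3) i = bUV t (2 * t + 3) j) : i = j := by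
  have h1 := sum_UV t i hi ht
  have h2 := sum_UV t j hj ht
  have h3 : cd t 3 i = cd t 3 j := by omega
  have h4 := cd3_cases t i hi ht
  have h5 := cd3_cases t j hj ht
  have h6 : i = j ∨ i + j = 6 ∨ i + j = 6 + 4 * t := by omega
  clear h1 h2 h3 h4 h5 hb hc
  have h7 := cd0_cases t i hi
  have h8 := cd0_cases t j hj
  unfold aUV fUU fUV at ha
  rcases h6 with h | h | h
  · exact h
  · omega
  · omega

/-- outer edge: 4-way piecewise description of a -/
theorem aUU_cases (t i : ℕ) (hi : i < 4 * t) (ht : 4 ≤ t) :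
    ∃ m, ((i < 2 * t ∧ m = i) ∨ (2 * t ≤ i ∧ m + i + 1 = 4 * t)) ∧ aUU t i = fUU m := by
  have h := mod_cases (4 * t) i 1 hi (by omega)
  have h' := cd0_cases t i hi
  have h'' := cd0_cases t ((i + 1) % (4 * t)) (Nat.mod_lt _ (by omega))
  by_cases hh : i < 2 * t
  · refine ⟨i, by omega, ?_⟩
    unfold aUU fUU; omega
  · refine ⟨4 * t - i - 1, by omega, ?_⟩
    unfold aUU fUU; omega

theorem bUU_cases (t i : ℕ) (hi : i < 4 * t) (ht : 4 ≤ t) :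
    ((i < 3 ∧ bUU t 3 i = (2 - i + 1) / 2 + 1)) ∨
    (3 ≤ i ∧ i < 2 * t + 3 ∧ bUU t 3 i = (i - 3 + 1) / 2 + 1) ∨
    (2 * t + 3 ≤ i ∧ bUU t 3 i = (4 * t + 2 - i + 1) / 2 + 1) := by
  have h := mod_cases (4 * t) i 1 hi (by omega)
  have h' := cd3_cases t i hi ht
  have h'' := cd3_cases t ((i + 1) % (4 * t)) (Nat.mod_lt _ (by omega)) ht
  unfold bUU fUV; omega

theorem inj_UU (t i j : ℕ) (hi : i < 4 * t) (hj : j < 4 * t) (ht : 4 ≤ t)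
    (ha : aUU t i = aUU t j) (hb : bUU t 3 i = bUU t 3 j) : i = j := by
  have h1 := bUU_cases t i hi ht
  have h2 := bUU_cases t j hj ht
  rw [hb] at h1
  generalize bUU t 3 j = b at *
  obtain ⟨m, h3, h4⟩ := aUU_cases t i hi ht
  obtain ⟨k, h5, h6⟩ := aUU_cases t j hj ht
  rw [h4, h6] at ha
  clear h4 h6 hb
  unfold fUU at ha
  rcases h1 with h1 | h1 | h1 <;> rcases h2 with h2 | h2 | h2 <;>
    rcases h3 with h3 | h3 <;> rcases h5 with h5 | h5 <;> omega

theorem aVV_cases (t i : ℕ) (hi : i < 4 * t) (ht : 4 ≤ t) :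
    (i < 2 * t ∧ aVV t i = (i + 1) / 2 + 1) ∨
    (2 * t ≤ i ∧ i + 1 < 4 * t ∧ aVV t i = (4 * t - 2 - i + 1) / 2 + 1) ∨
    (i + 1 = 4 * t ∧ aVV t i = 2) := by
  have h := mod_cases (4 * t) i 2 hi (by omega)
  have h' := cd0_cases t i hi
  have h'' := cd0_cases t ((i + 2) % (4 * t)) (Nat.mod_lt _ (by omega))
  unfold aVV fUV; omega

theorem mVV_cases (t i : ℕ) (hi : i < 4 * t) (ht : 4 ≤ t) (M : ℕ)
    (hM : M = min (cd t 3 i) (cd t 3 ((i + 2) % (4 * t)))) :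
    (i < 2 ∧ M + i = 1) ∨ (i = 2 ∧ M = 1) ∨
    (3 ≤ i ∧ i < 2 * t + 3 ∧ i ≠ 2 * t + 2 ∧ M + 3 = i) ∨
    (i = 2 * t + 2 ∧ M + 1 = 2 * t) ∨
    (2 * t + 3 ≤ i ∧ M + i = 4 * t + 1) := by
  have h := mod_cases (4 * t) i 2 hi (by omega)
  have h' := cd3_cases t i hi ht
  have h'' := cd3_cases t ((i + 2) % (4 * t)) (Nat.mod_lt _ (by omega)) ht
  omega

theorem inj_VV (t i j : ℕ) (hi : i < 4 * t) (hj : j < 4 * t) (ht : 4 ≤ t)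
    (ha : aVV t i = aVV t j) (hb : bVV t 3 i = bVV t 3 j)
    (hc : bVV t (2 * t + 3) i = bVV t (2 * t + 3) j) : i = j := by
  have h1 := sum_VV t i hi ht
  have h2 := sum_VV t j hj ht
  have h3 := mVV_cases t i hi ht _ rfl
  have h4 := mVV_cases t j hj ht _ rfl
  have hM : min (cd t 3 i) (cd t 3 ((i + 2) % (4 * t))) =
      min (cd t 3 j) (cd t 3 ((j + 2) % (4 * t))) := by
    generalize min (cd t 3 i) (cd t 3 ((i + 2) % (4 * t))) = M at *
    generalize min (cd t 3 j) (cd t 3 ((j + 2) % (4 * t))) = N at *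
    omega
  rw [hM] at h3
  generalize min (cd t 3 j) (cd t 3 ((j + 2) % (4 * t))) = N at *
  clear h1 h2 hb hc hM
  have h5 := aVV_cases t i hi ht
  have h6 := aVV_cases t j hj ht
  rw [ha] at h5
  generalize aVV t j = a at *
  rcases h3 with h3 | h3 | h3 | h3 | h3 <;> rcases h4 with h4 | h4 | h4 | h4 | h4 <;>
    rcases h5 with h5 | h5 | h5 <;> rcases h6 with h6 | h6 | h6 <;> omega

theorem edge_cases (t : ℕ) (ht : 4 ≤ t) (e : Sym2 (Fin (4 * t) ⊕ Fin (4 * t)))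
    (he : e ∈ (GP (4 * t) 2).edgeSet) :
    ∃ (i : ℕ) (hi : i < 4 * t),
      e = s(.inl ⟨i, hi⟩, .inl ⟨(i + 1) % (4 * t), Nat.mod_lt _ (by omega)⟩) ∨
      e = s(.inl ⟨i, hi⟩, .inr ⟨i, hi⟩) ∨
      e = s(.inr ⟨i, hi⟩, .inr ⟨(i + 2) % (4 * t), Nat.mod_lt _ (by omega)⟩) := by
  induction e with
  | h x y =>
    rw [mem_edgeSet] at he
    refine adj_cases_s11 t ht (fun x y => ∃ (i : ℕ) (hi : i < 4 * t),
      s(x, y) = s(.inl ⟨i, hi⟩, .inl ⟨(i + 1) % (4 * t), Nat.mod_lt _ (by omega)⟩) ∨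
      s(x, y) = s(.inl ⟨i, hi⟩, .inr ⟨i, hi⟩) ∨
      s(x, y) = s(.inr ⟨i, hi⟩, .inr ⟨(i + 2) % (4 * t), Nat.mod_lt _ (by omega)⟩))
      ?_ ?_ ?_ ?_ x y he
    · intro x y h
      rw [Sym2.eq_swap]; exact h
    · exact fun i hi hi' => ⟨i, hi, .inl rfl⟩
    · exact fun i hi => ⟨i, hi, .inr (.inl rfl)⟩
    · exact fun i hi hi' => ⟨i, hi, .inr (.inr rfl)⟩

theorem gen (t : ℕ) (ht : 4 ≤ t) (h0 : 0 < 4 * t) (h3 : 3 < 4 * t) (h4 : 2 * t + 3 < 4 * t) :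
    IsEdgeGenerator (GP (4 * t) 2)
      {Sum.inl ⟨0, h0⟩, Sum.inr ⟨3, h3⟩, Sum.inr ⟨2 * t + 3, h4⟩} := by
  intro e he e' he' h
  have ha := h (.inl ⟨0, h0⟩) (by simp)
  have hb := h (.inr ⟨3, h3⟩) (by simp)
  have hc := h (.inr ⟨2 * t + 3, h4⟩) (by simp)
  clear h
  obtain ⟨i, hi, h⟩ := edge_cases t ht e he
  obtain ⟨j, hj, h'⟩ := edge_cases t ht e' he'
  have eU := fun x => (dist_U t 0 h0 ht x).2
  have e3 := fun x => (dist_V t 3 h3 ht x).2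
  have e4 := fun x => (dist_V t (2 * t + 3) h4 ht x).2
  have su := sum_UU t i hi ht
  have su' := sum_UU t j hj ht
  have sw := sum_UV t i hi ht
  have sw' := sum_UV t j hj ht
  have sv := sum_VV t i hi ht
  have sv' := sum_VV t j hj ht
  rcases h with rfl | rfl | rfl <;> rcases h' with rfl | rfl | rfl <;>
    simp only [edgeDist, Sym2.lift_mk, eU, e3, e4, Sum.elim_inl, Sum.elim_inr] at ha hb hc
  · obtain rfl := inj_UU t i j hi hj ht ha hb
    rfl
  · change bUU t _ i = bUV t _ j at hb
    change bUU t _ i = bUV t _ j at hc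
    clear sv sv'
    omega
  · change bUU t _ i = bVV t _ j at hb
    change bUU t _ i = bVV t _ j at hc
    clear sv sw sw'
    omega
  · change bUV t _ i = bUU t _ j at hb
    change bUV t _ i = bUU t _ j at hc
    clear sv sv'
    omega
  · obtain rfl := inj_UV t i j hi hj ht ha hb hc
    rfl
  · change bUV t _ i = bVV t _ j at hb
    change bUV t _ i = bVV t _ j at hc
    clear sv sw'
    omega
  · change bVV t _ i = bUU t _ j at hb
    change bVV t _ i = bUU t _ j at hc
    clear sv' sw sw'
    omega
  · change bVV t _ i = bUV t _ j at hb
    change bVV t _ i = bUV t _ j at hc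
    clear sv' sw
    omega
  · obtain rfl := inj_VV t i j hi hj ht ha hb hc
    rfl

theorem deg3 (t : ℕ) (ht : 4 ≤ t) (w : Fin (4 * t) ⊕ Fin (4 * t)) :
    ∃ x y z, (GP (4 * t) 2).Adj w x ∧ (GP (4 * t) 2).Adj w y ∧ (GP (4 * t) 2).Adj w z ∧
      x ≠ y ∧ x ≠ z ∧ y ≠ z := by
  have key : ∀ i k, i < 4 * t → 1 ≤ k → k ≤ 2 → ∃ a b, a < 4 * t ∧ b < 4 * t ∧ a ≠ b ∧
      (a = i + k ∨ a + 4 * t = i + k) ∧ (i = b + k ∨ i + 4 * t = b + k) := by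
    intro i k hi hk hk'
    refine ⟨if i + k < 4 * t then i + k else i + k - 4 * t,
      if k ≤ i then i - k else i + 4 * t - k, ?_, ?_, ?_, ?_, ?_⟩ <;> split_ifs <;> omega
  rcases w with ⟨i, hi⟩ | ⟨i, hi⟩
  · obtain ⟨a, b, ha, hb, hab, h1, h2⟩ := key i 1 hi (by omega) (by omega)
    exact ⟨.inl ⟨a, ha⟩, .inl ⟨b, hb⟩, .inr ⟨i, hi⟩, adj1 t ht _ _ _ _ h1,
      (adj1 t ht _ _ _ _ h2).symm, adj2 t i hi, by simpa using hab, by simp, by simp⟩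
  · obtain ⟨a, b, ha, hb, hab, h1, h2⟩ := key i 2 hi (by omega) (by omega)
    exact ⟨.inr ⟨a, ha⟩, .inr ⟨b, hb⟩, .inl ⟨i, hi⟩, adj3 t ht _ _ _ _ h1,
      (adj3 t ht _ _ _ _ h2).symm, (adj2 t i hi).symm, by simpa using hab, by simp, by simp⟩

theorem conn (t : ℕ) (ht : 4 ≤ t) : (GP (4 * t) 2).Connected := by
  have h0 : 0 < 4 * t := by omega
  haveI : Nonempty (Fin (4 * t) ⊕ Fin (4 * t)) := ⟨.inl ⟨0, h0⟩⟩
  exact ⟨fun x y => (dist_U t 0 h0 ht x).1.symm.trans (dist_U t 0 h0 ht y).1⟩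

/-- For `n = 4t`, `t ≥ 4`, `{u₀, v₃, v_{2t+3}}` is an edge metric
generator of `GP(n,2)` of size 3, hence `β_E(GP(4t,2)) = 3`. -/
theorem stmt11 (t : ℕ) (ht : 4 ≤ t) :
    IsEdgeGenerator (GP (4 * t) 2)
      {Sum.inl ⟨0, by omega⟩, Sum.inr ⟨3, by omega⟩, Sum.inr ⟨2 * t + 3, by omega⟩} ∧
    ({Sum.inl ⟨0, by omega⟩, Sum.inr ⟨3, by omega⟩, Sum.inr ⟨2 * t + 3, by omega⟩} :
      Set (Fin (4 * t) ⊕ Fin (4 * t))).ncard = 3 ∧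
    edgeMetricDim (GP (4 * t) 2) = 3 := by
  have hg := gen t ht (by omega) (by omega) (by omega)
  have hcard : ({Sum.inl ⟨0, by omega⟩, Sum.inr ⟨3, by omega⟩, Sum.inr ⟨2 * t + 3, by omega⟩} :
      Set (Fin (4 * t) ⊕ Fin (4 * t))).ncard = 3 := by
    rw [Set.ncard_eq_three]
    refine ⟨_, _, _, ?_, ?_, ?_, rfl⟩
    · simp
    · simp
    · simp; omega
  refine ⟨hg, hcard, ?_⟩
  unfold edgeMetricDim
  apply le_antisymm
  · exact Nat.sInf_le ⟨_, Set.toFinite _, hcard, hg⟩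
  · refine le_csInf ⟨3, _, Set.toFinite _, hcard, hg⟩ ?_
    rintro n ⟨S, hf, rfl, hS⟩
    exact three_le _ (conn t ht) (deg3 t ht) S hf hS
end
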